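/- arXiv:1607.03670 — 6 statements merged into one kernel-verified Lean document; each statement's English description precedes it below -/
import Mathlib

section
/- Let p be a prime and let K be an algebraic closure of ℚ_p equipped with its unique absolute value |·| extending the p-adic absolute value (normalized by |p| = p⁻¹). For every ε > 0 there exists r₀ such that for every integer r ≥ r₀ the following holds: with d = p^{2r}, ζ ∈ K a primitive d-th root of unity, and J ∈ K^d defined by J_i = 1 if p^r divides i and J_i = 0 otherwise (0 ≤ i ≤ d−1), there exists a vector x ∈ K^d with max_{0≤i≤d−1} |x_i − J_i| ≤ ε and max_{0≤i≤d−1} |p^{-r} Σ_{j=0}^{d−1} ζ^{ij} x_j| ≤ ε. -/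
section RootsOfUnity

open Polynomial Finset

variable {K : Type*} [NormedField K]

theorem IsPrimitiveRoot.norm_eq_one_of_neZero {x : K} {n : ℕ} [NeZero n]
    (hx : IsPrimitiveRoot x n) : ‖x‖ = 1 :=
  (pow_eq_one_iff_of_nonneg (norm_nonneg x) (NeZero.ne n)).1 (by simp [← norm_pow, hx.pow_eq_one])

variable [IsUltrametricDist K]

theorem norm_one_sub_pow_le {x : K} (hx : ‖x‖ = 1) (a : ℕ) : ‖1 - x ^ a‖ ≤ ‖1 - x‖ := by
  rw [← mul_neg_geom_sum x a, norm_mul]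
  refine mul_le_of_le_one_right (norm_nonneg _) ?_
  exact IsUltrametricDist.norm_sum_le_of_forall_le_of_nonneg zero_le_one fun i _ => by simp [hx]

theorem norm_pow_sub_pow_le {x : K} (hx : ‖x‖ = 1) (a b : ℕ) : ‖x ^ a - x ^ b‖ ≤ ‖1 - x‖ := by
  rcases le_total a b with h | h
  · obtain ⟨c, rfl⟩ := Nat.exists_eq_add_of_le h
    rw [show x ^ a - x ^ (a + c) = x ^ a * (1 - x ^ c) by ring, norm_mul, norm_pow, hx, one_pow,
      one_mul]
    exact norm_one_sub_pow_le hx c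
  · obtain ⟨c, rfl⟩ := Nat.exists_eq_add_of_le h
    rw [show x ^ (b + c) - x ^ b = -(x ^ b * (1 - x ^ c)) by ring, norm_neg, norm_mul, norm_pow, hx,
      one_pow, one_mul]
    exact norm_one_sub_pow_le hx c

theorem norm_one_sub_le_one {x : K} (hx : ‖x‖ = 1) : ‖1 - x‖ ≤ 1 := by
  simpa [hx, sub_eq_add_neg] using IsUltrametricDist.norm_add_le_max 1 (-x)

theorem IsPrimitiveRoot.norm_one_sub_eq {η μ : K} {n : ℕ} [NeZero n] (hη : IsPrimitiveRoot η n)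
    (hμ : IsPrimitiveRoot μ n) : ‖1 - η‖ = ‖1 - μ‖ := by
  obtain ⟨a, -, rfl⟩ := hη.eq_pow_of_pow_eq_one hμ.pow_eq_one
  obtain ⟨b, -, hb⟩ := hμ.eq_pow_of_pow_eq_one hη.pow_eq_one
  refine le_antisymm ?_ (norm_one_sub_pow_le hη.norm_eq_one_of_neZero a)
  conv_lhs => rw [← hb]
  exact norm_one_sub_pow_le hμ.norm_eq_one_of_neZero b

theorem IsPrimitiveRoot.norm_one_sub_pow_totient {p : ℕ} [Fact p.Prime] {η : K} {s : ℕ}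
    (hη : IsPrimitiveRoot η (p ^ (s + 1))) :
    ‖1 - η‖ ^ (p ^ s * (p - 1)) = ‖(p : K)‖ := by
  have h := eval_one_cyclotomic_prime_pow (R := K) (p := p) s
  rw [cyclotomic_eq_prod_X_sub_primitiveRoots hη, eval_prod] at h
  rw [← h, norm_prod, ← Nat.totient_prime_pow_succ Fact.out, ← hη.card_primitiveRoots]
  refine (Finset.prod_eq_pow_card fun μ hμ => ?_).symm
  rw [mem_primitiveRoots (NeZero.pos _)] at hμ
  simpa using hμ.norm_one_sub_eq hη

theorem IsPrimitiveRoot.norm_one_sub_pow_prime_pow {p : ℕ} [Fact p.Prime] {η : K} {s n : ℕ}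
    (hη : IsPrimitiveRoot η (p ^ (s + n + 1))) : ‖1 - η ^ p ^ n‖ = ‖1 - η‖ ^ p ^ n := by
  have hp : p.Prime := Fact.out
  have h' : IsPrimitiveRoot (η ^ p ^ n) (p ^ (s + 1)) := hη.pow (pow_pos hp.pos _) (by ring)
  have h₁ := hη.norm_one_sub_pow_totient
  rw [← h'.norm_one_sub_pow_totient, add_comm, pow_add, mul_assoc, pow_mul] at h₁
  exact ((pow_left_inj₀ (by positivity) (by positivity)
    (mul_ne_zero (NeZero.ne _) (by have := hp.two_le; omega))).1 h₁).symm

theorem Finset.prod_range_mul_eq {M : Type*} [CommMonoid M] (f : ℕ → M) (p n : ℕ) :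
    ∏ j ∈ range (p * n), f j = ∏ i ∈ range p, ∏ j ∈ range n, f (p * j + i) := by
  induction n with
  | zero => simp
  | succ n ih => simp [mul_add, prod_range_add, ih, prod_range_succ, prod_mul_distrib]

theorem prod_norm_pow_sub_pow_le {p : ℕ} (hp : p.Prime) (k : ℕ) {q : K} (hq : ‖q‖ = 1) {M : ℝ}
    (hM : ∀ i < k, ‖1 - q ^ p ^ i‖ ^ p ^ (k - 1 - i) ≤ M) (x : ℕ) :
    ∏ j ∈ range (p ^ k), ‖q ^ x - q ^ j‖ ≤ M ^ ((p - 1) * k) := by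
  induction k generalizing q x with
  | zero =>
    simpa using (norm_pow_sub_pow_le hq x 0).trans (norm_one_sub_le_one hq)
  | succ k ih =>
    have hM0 : 0 ≤ M := le_trans (by positivity) (hM 0 k.succ_pos)
    have hx : x % p ∈ range p := mem_range.2 (Nat.mod_lt _ hp.pos)
    rw [pow_succ', prod_range_mul_eq, ← mul_prod_erase _ _ hx, mul_add_one, add_comm,
      pow_add]
    rw [mul_comm]
    refine mul_le_mul ?_ ?_ (by positivity) (by positivity)
    · rw [← card_range p, ← card_erase_of_mem hx, card_range]
      have h0 := hM 0 k.succ_pos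
      simp only [pow_zero, pow_one, Nat.add_sub_cancel, Nat.sub_zero] at h0
      refine (prod_le_prod (fun _ _ => prod_nonneg fun _ _ => norm_nonneg _) fun i _ =>
        (prod_le_prod (fun _ _ => norm_nonneg _)
          fun j _ => norm_pow_sub_pow_le hq x (p * j + i)).trans ?_).trans_eq (prod_const M)
      simpa using h0
    · have := ih (q := q ^ p) (by simp [hq]) (fun i hi => ?_) (x / p)
      · refine le_trans (le_of_eq (prod_congr rfl fun j _ => ?_)) this
        conv_lhs => rw [← Nat.div_add_mod x p]
        simp only [pow_add, Nat.mul_add_mod_self_left, Nat.mod_mod, ← sub_mul, norm_mul, norm_pow, hq,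
          one_pow, mul_one, pow_mul]
      · have := hM (i + 1) (by omega)
        rwa [pow_succ', pow_mul, show k + 1 - 1 - (i + 1) = k - 1 - i by omega] at this

theorem IsPrimitiveRoot.prod_X_sub_C_pow {R : Type*} [CommRing R] [IsDomain R] {η : R} {N : ℕ}
    (hN : 0 < N) (hη : IsPrimitiveRoot η N) :
    ∏ j ∈ range N, (X - C (η ^ j)) = (X ^ N - 1 : R[X]) := by
  classical
  rw [X_pow_sub_one_eq_prod hN hη]
  have := NeZero.of_pos hN
  refine prod_bij (fun j _ => η ^ j) (fun j _ => ?_) (fun i hi j hj h => ?_) (fun μ hμ => ?_)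
    (fun _ _ => rfl)
  · rw [Polynomial.mem_nthRootsFinset hN, ← pow_mul, mul_comm, pow_mul, hη.pow_eq_one, one_pow]
  · exact hη.pow_inj (mem_range.1 hi) (mem_range.1 hj) h
  · obtain ⟨j, hj, h⟩ := hη.eq_pow_of_pow_eq_one ((Polynomial.mem_nthRootsFinset hN _).1 hμ)
    exact ⟨j, mem_range.2 hj, h⟩

theorem cyclotomic_dvd_coeff_prod_sub {N : ℕ} (hN : 0 < N) (i : ℕ) :
    cyclotomic N ℤ ∣ (∏ j ∈ range N, (X - C (X ^ j)) - (X ^ N - 1) : ℤ[X][X]).coeff i := by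
  have hprim := Complex.isPrimitiveRoot_exp N hN.ne'
  rw [cyclotomic_eq_minpoly hprim hN]
  refine minpoly.isIntegrallyClosed_dvd (hprim.isIntegral hN) ?_
  rw [← AlgHom.coe_toRingHom, ← coeff_map]
  have := hprim.prod_X_sub_C_pow hN
  rw [show Polynomial.map _ _ = (0 : ℂ[X]) from ?_, coeff_zero]
  rw [← sub_eq_zero] at this
  rw [← this]
  simp [Polynomial.map_prod]

theorem norm_aeval_int_le_one {q : K} (hq : ‖q‖ ≤ 1) (E : ℤ[X]) : ‖aeval q E‖ ≤ 1 := by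
  rw [aeval_eq_sum_range]
  refine IsUltrametricDist.norm_sum_le_of_forall_le_of_nonneg zero_le_one fun i _ => ?_
  rw [zsmul_eq_mul, norm_mul, norm_pow]
  exact mul_le_one₀ (IsUltrametricDist.norm_intCast_le_one _ _) (by positivity)
    (pow_le_one₀ (norm_nonneg _) hq)

theorem norm_coeff_prod_sub_le {q : K} (hq : ‖q‖ ≤ 1) {N : ℕ} (hN : 0 < N) (i : ℕ) :
    ‖(∏ j ∈ range N, (X - C (q ^ j)) - (X ^ N - 1)).coeff i‖ ≤ ‖(cyclotomic N K).eval q‖ := by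
  obtain ⟨E, hE⟩ := cyclotomic_dvd_coeff_prod_sub hN i
  have : (∏ j ∈ range N, (X - C (q ^ j)) - (X ^ N - 1)) =
      (∏ j ∈ range N, (X - C (X ^ j)) - (X ^ N - 1) : ℤ[X][X]).map
        (aeval q : ℤ[X] →ₐ[ℤ] K).toRingHom := by
    simp [Polynomial.map_prod]
  rw [this, coeff_map, hE, AlgHom.toRingHom_eq_coe, AlgHom.coe_toRingHom, map_mul, norm_mul]
  refine (mul_le_of_le_one_right (norm_nonneg _) (norm_aeval_int_le_one hq E)).trans_eq ?_
  rw [← map_cyclotomic_int N K, eval_map, aeval_def]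
  rfl

end RootsOfUnity

section Gauge

open Polynomial Finset

variable {K E : Type*} [NormedField K] [AddCommGroup E] [Module K E]

/-- A family of balls `S ρ` in a `K`-vector space, closed under addition, compatible with scaling
and stable under two endomorphisms `U` and `V`. -/
structure IsStableGauge (S : ℝ → E → Prop) (U V : Module.End K E) : Prop where
  mono : ∀ {ρ ρ' f}, ρ ≤ ρ' → S ρ f → S ρ' f
  zero : ∀ {ρ}, 0 ≤ ρ → S ρ 0
  add : ∀ {ρ f g}, S ρ f → S ρ g → S ρ (f + g)
  smul : ∀ {ρ f} (c : K), S ρ f → S (‖c‖ * ρ) (c • f)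
  left : ∀ {ρ f}, S ρ f → S ρ (U f)
  right : ∀ {ρ f}, S ρ f → S ρ (V f)

namespace IsStableGauge

variable {S : ℝ → E → Prop} {U V : Module.End K E}

theorem symm (h : IsStableGauge S U V) : IsStableGauge S V U :=
  { h with left := h.right, right := h.left }

theorem sub (h : IsStableGauge S U V) {ρ : ℝ} {f g : E} (hf : S ρ f) (hg : S ρ g) :
    S ρ (f - g) := by
  simpa [sub_eq_add_neg] using h.add hf (by simpa using h.smul (-1) hg)

theorem left_pow (h : IsStableGauge S U V) {ρ : ℝ} {f : E} (hf : S ρ f) (n : ℕ) :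
    S ρ ((U ^ n) f) := by
  induction n with
  | zero => simpa
  | succ n ih => rw [pow_succ']; exact h.left ih

theorem aeval_left (h : IsStableGauge S U V) {ρ κ : ℝ} (hρ : 0 ≤ ρ) (hκ : 0 ≤ κ) {f : E}
    (hf : S ρ f) {P : K[X]} (hP : ∀ i, ‖P.coeff i‖ ≤ κ) : S (κ * ρ) (aeval U P f) := by
  rw [aeval_eq_sum_range, LinearMap.sum_apply]
  exact sum_induction _ _ (fun _ _ => h.add) (h.zero (by positivity)) fun i _ =>
    h.mono (mul_le_mul_of_nonneg_right (hP i) hρ) (h.smul _ (h.left_pow hf i))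

theorem pow_sub_one_left (h : IsStableGauge S U V) {ρ δ w : ℝ} (hρ : 0 ≤ ρ) (hw : 0 ≤ w) {J : E}
    (hJ : S ρ J) {P : K[X]} {m : ℕ} (hP : ∀ i, ‖(P - (X ^ m - 1)).coeff i‖ ≤ w)
    (hδ : S δ (aeval U P J)) : S (max δ (w * ρ)) ((U ^ m) J - J) := by
  have := h.sub (h.mono (le_max_left δ (w * ρ)) hδ)
    (h.mono (le_max_right δ (w * ρ)) (h.aeval_left hρ hw hJ hP))
  simpa using this

/-- If `U ^ m` and `V ^ m` almost fix `J` but commute only up to a scalar `τ`, then `J` is small. -/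
theorem contract (h : IsStableGauge S U V) {ρ δ w : ℝ} (hρ : 0 ≤ ρ) (hw : 0 ≤ w) {J : E}
    (hJ : S ρ J) {P : K[X]} {m d : ℕ} (hP : ∀ i, ‖(P - (X ^ m - 1)).coeff i‖ ≤ w)
    (hU : S δ (aeval U P J)) (hV : S δ (aeval V P J)) {τ : K} (hτ : τ ≠ 1)
    (hcomm : U ^ m * V ^ m = τ • (V ^ m * U ^ m)) (hd : 0 < d) (hUd : U ^ d = 1) (hVd : V ^ d = 1) :
    S (max δ (w * ρ) / ‖1 - τ‖) J := by
  have hy := h.symm.pow_sub_one_left hρ hw hJ hP hV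
  have hz := h.pow_sub_one_left hρ hw hJ hP hU
  set σ := max δ (w * ρ)
  have key : S σ ((τ - 1) • (V ^ m) ((U ^ m) J)) := by
    have e : (τ - 1) • (V ^ m) ((U ^ m) J) =
        ((U ^ m) ((V ^ m) J - J) - ((V ^ m) J - J)) -
          ((V ^ m) ((U ^ m) J - J) - ((U ^ m) J - J)) := by
      have := LinearMap.congr_fun hcomm J
      simp only [Module.End.mul_apply, LinearMap.smul_apply] at this
      simp only [map_sub, this, sub_smul, one_smul]
      abel
    rw [e]
    exact h.sub (h.sub (h.left_pow hy m) hy) (h.sub (h.symm.left_pow hz m) hz)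
  have hinv : ∀ T : Module.End K E, T ^ d = 1 → T ^ (m * (d - 1)) * T ^ m = 1 := fun T hT => by
    rw [← pow_add, ← Nat.mul_add_one, Nat.sub_add_cancel hd, mul_comm, pow_mul, hT, one_pow]
  have h0 : τ - 1 ≠ 0 := sub_ne_zero.2 hτ
  have := h.left_pow (h.symm.left_pow (h.smul (τ - 1)⁻¹ key) (m * (d - 1))) (m * (d - 1))
  rw [inv_smul_smul₀ h0, ← Module.End.mul_apply (V ^ _), hinv V hVd, Module.End.one_apply,
    ← Module.End.mul_apply, hinv U hUd, Module.End.one_apply] at this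
  rwa [norm_inv, inv_mul_eq_div, norm_sub_rev] at this

theorem iterate_contract (h : IsStableGauge S U V) {δ w : ℝ} (hw : 0 ≤ w) {J : E}
    (hJ : S 1 J) {P : K[X]} {m d : ℕ} (hP : ∀ i, ‖(P - (X ^ m - 1)).coeff i‖ ≤ w)
    (hU : S δ (aeval U P J)) (hV : S δ (aeval V P J)) {τ : K} (hτ : w < ‖1 - τ‖)
    (hcomm : U ^ m * V ^ m = τ • (V ^ m * U ^ m)) (hd : 0 < d) (hUd : U ^ d = 1) (hVd : V ^ d = 1)
    {ε : ℝ} (hε : 0 < ε) (hδε : δ ≤ ε * ‖1 - τ‖) : S ε J := by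
  have hs : 0 < ‖1 - τ‖ := hw.trans_lt hτ
  have hτ1 : τ ≠ 1 := fun h => by simp [h] at hs
  have hθ : w / ‖1 - τ‖ < 1 := (div_lt_one hs).2 hτ
  have hθ0 : 0 ≤ w / ‖1 - τ‖ := by positivity
  have key : ∀ N : ℕ, S (max ε ((w / ‖1 - τ‖) ^ N)) J := fun N => by
    induction N with
    | zero => exact h.mono (by simp) hJ
    | succ N ih =>
      refine h.mono ?_ (h.contract (by positivity) hw ih hP hU hV hτ1 hcomm hd hUd hVd)
      rw [div_le_iff₀ hs]
      refine max_le (hδε.trans (mul_le_mul_of_nonneg_right (le_max_left _ _) hs.le)) ?_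
      rw [← div_le_iff₀ hs, mul_div_right_comm, mul_max_of_nonneg _ _ hθ0, ← pow_succ']
      exact max_le_max (mul_le_of_le_one_left hε.le hθ.le) le_rfl
  obtain ⟨N, hN⟩ := exists_pow_lt_of_lt_one hε hθ
  exact h.mono (max_le le_rfl hN.le) (key N)

end IsStableGauge

end Gauge

section Fourier

open Polynomial Finset

variable {K : Type*} [NormedField K] {d : ℕ}

/-- Translation by one on functions on `ZMod d`. -/
def translation (K : Type*) [NormedField K] (d : ℕ) : Module.End K (ZMod d → K) :=
  LinearMap.funLeft K K (· + 1)

/-- Multiplication by the values of a character. -/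
def modulation (χ : AddChar (ZMod d) K) : Module.End K (ZMod d → K) :=
  LinearMap.mulLeft K (χ : ZMod d → K)

variable (χ : AddChar (ZMod d) K)

theorem translation_pow_apply (n : ℕ) (f : ZMod d → K) (i : ZMod d) :
    (translation K d ^ n) f i = f (i + n) := by
  induction n generalizing f i with
  | zero => simp
  | succ n ih =>
    rw [pow_succ, Module.End.mul_apply, ih]
    simp [translation, LinearMap.funLeft_apply, add_assoc]

theorem modulation_pow_apply (n : ℕ) (f : ZMod d → K) (i : ZMod d) :
    (modulation χ ^ n) f i = χ i ^ n * f i := by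
  simp [modulation, LinearMap.pow_mulLeft]

theorem aeval_modulation_apply (P : K[X]) (f : ZMod d → K) (i : ZMod d) :
    aeval (modulation χ) P f i = P.eval (χ i) * f i := by
  simp [aeval_eq_sum_range, eval_eq_sum_range, sum_mul, modulation_pow_apply, mul_assoc]

theorem translation_pow_mul_modulation_pow (m n : ℕ) :
    translation K d ^ m * modulation χ ^ n =
      χ (m * n) • (modulation χ ^ n * translation K d ^ m) := by
  refine LinearMap.ext fun f => funext fun i => ?_
  simp only [Module.End.mul_apply, LinearMap.smul_apply, Pi.smul_apply, smul_eq_mul,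
    translation_pow_apply, modulation_pow_apply]
  rw [AddChar.map_add_eq_mul, mul_pow, ← AddChar.map_nsmul_eq_pow χ n (m : ZMod d), nsmul_eq_mul,
    mul_comm (n : ZMod d)]
  ring

theorem translation_pow_card : translation K d ^ d = 1 :=
  LinearMap.ext fun f => funext fun i => by simp [translation_pow_apply]

theorem modulation_pow_card : modulation χ ^ d = 1 :=
  LinearMap.ext fun f => funext fun i => by
    simp [modulation_pow_apply, ← AddChar.map_nsmul_eq_pow]

variable [NeZero d] (c : K)

/-- The Fourier transform on `ZMod d` attached to a character, normalized by a constant `c`. -/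
def zmodFourier : Module.End K (ZMod d → K) where
  toFun f i := c * ∑ j, χ (i * j) * f j
  map_add' f g := by ext i; simp [mul_add, sum_add_distrib]
  map_smul' a f := by ext i; simp [mul_sum, mul_left_comm]

theorem zmodFourier_apply (f : ZMod d → K) (i : ZMod d) :
    zmodFourier χ c f i = c * ∑ j, χ (i * j) * f j := rfl

theorem zmodFourier_translation (f : ZMod d → K) (i : ZMod d) :
    zmodFourier χ c (translation K d f) i = χ (-i) * zmodFourier χ c f i := by
  rw [zmodFourier_apply, zmodFourier_apply, mul_left_comm]
  congr 1
  rw [mul_sum]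
  refine Fintype.sum_equiv (Equiv.addRight (1 : ZMod d)) _ _ fun j => ?_
  rw [← mul_assoc, ← AddChar.map_add_eq_mul]
  simp [translation, LinearMap.funLeft_apply, mul_add]

theorem zmodFourier_modulation (f : ZMod d → K) (i : ZMod d) :
    zmodFourier χ c (modulation χ f) i = zmodFourier χ c f (i + 1) := by
  simp [zmodFourier_apply, modulation, add_mul, AddChar.map_add_eq_mul, mul_assoc]

theorem zmodFourier_translation_pow (n : ℕ) (f : ZMod d → K) (i : ZMod d) :
    zmodFourier χ c ((translation K d ^ n) f) i = χ (-i) ^ n * zmodFourier χ c f i := by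
  induction n generalizing f with
  | zero => simp
  | succ n ih => rw [pow_succ, Module.End.mul_apply, ih, zmodFourier_translation, pow_succ,
      mul_assoc]

theorem zmodFourier_aeval_translation (P : K[X]) (f : ZMod d → K) (i : ZMod d) :
    zmodFourier χ c (aeval (translation K d) P f) i = P.eval (χ (-i)) * zmodFourier χ c f i := by
  simp [aeval_eq_sum_range, eval_eq_sum_range, sum_mul, zmodFourier_translation_pow, mul_assoc]

/-- `f` is the sum of a function of sup norm at most `ρ` and one whose Fourier transform has sup
norm at most `ρ`. -/
def IsSmallSum (ρ : ℝ) (f : ZMod d → K) : Prop :=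
  ∃ g : ZMod d → K, (∀ i, ‖g i‖ ≤ ρ) ∧ ∀ i, ‖zmodFourier χ c (f - g) i‖ ≤ ρ

theorem isSmallSum_of_norm_le {ρ : ℝ} (hρ : 0 ≤ ρ) {f : ZMod d → K} (hf : ∀ i, ‖f i‖ ≤ ρ) :
    IsSmallSum χ c ρ f :=
  ⟨f, hf, by simpa⟩

theorem isStableGauge_isSmallSum [IsUltrametricDist K] :
    IsStableGauge (IsSmallSum χ c) (translation K d) (modulation χ) where
  mono := fun hle ⟨g, h₁, h₂⟩ => ⟨g, fun i => (h₁ i).trans hle, fun i => (h₂ i).trans hle⟩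
  zero := fun hρ => ⟨0, by simpa, by simpa⟩
  add := by
    rintro ρ f f' ⟨g, h₁, h₂⟩ ⟨g', h₁', h₂'⟩
    refine ⟨g + g', fun i => ?_, fun i => ?_⟩
    · exact (IsUltrametricDist.norm_add_le_max _ _).trans (max_le (h₁ i) (h₁' i))
    · rw [add_sub_add_comm, map_add]
      exact (IsUltrametricDist.norm_add_le_max _ _).trans (max_le (h₂ i) (h₂' i))
  smul := by
    rintro ρ f a ⟨g, h₁, h₂⟩
    refine ⟨a • g, fun i => ?_, fun i => ?_⟩
    · simpa using mul_le_mul_of_nonneg_left (h₁ i) (norm_nonneg a)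
    · rw [← smul_sub, map_smul]
      simpa using mul_le_mul_of_nonneg_left (h₂ i) (norm_nonneg a)
  left := by
    rintro ρ f ⟨g, h₁, h₂⟩
    refine ⟨translation K d g, fun i => h₁ _, fun i => ?_⟩
    rw [← map_sub, zmodFourier_translation, norm_mul, AddChar.norm_apply, one_mul]
    exact h₂ i
  right := by
    rintro ρ f ⟨g, h₁, h₂⟩
    refine ⟨modulation χ g, fun i => ?_, fun i => ?_⟩
    · simpa [modulation, AddChar.norm_apply] using h₁ i
    · rw [← map_sub, zmodFourier_modulation]
      exact h₂ _

end Fourier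

section SubgroupIndicator

open Polynomial Finset

variable {K : Type*} [NormedField K] {d N : ℕ}

/-- The indicator function of the `N`-torsion subgroup of `ZMod d`. -/
def torsionIndicator (K : Type*) [NormedField K] (d N : ℕ) : ZMod d → K :=
  fun j => if (N : ZMod d) * j = 0 then 1 else 0

theorem torsionIndicator_natCast (hN : 0 < N) (hd : d = N * N) (n : ℕ) :
    torsionIndicator K d N n = if N ∣ n then 1 else 0 := by
  subst hd
  simp only [torsionIndicator, ← Nat.cast_mul, ZMod.natCast_eq_zero_iff,
    Nat.mul_dvd_mul_iff_left hN]

theorem norm_torsionIndicator_le_one (i : ZMod d) : ‖torsionIndicator K d N i‖ ≤ 1 := by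
  unfold torsionIndicator
  split_ifs <;> simp

theorem norm_eval_mul_torsionIndicator_le {P : K[X]} {δ : ℝ} (hδ : 0 ≤ δ)
    (hP : ∀ μ : K, μ ^ N = 1 → ‖P.eval μ‖ ≤ δ) (χ : AddChar (ZMod d) K) {i j : ZMod d}
    (hij : (N : ZMod d) * i = 0 → (N : ZMod d) * j = 0) :
    ‖P.eval (χ j) * torsionIndicator K d N i‖ ≤ δ := by
  unfold torsionIndicator
  split_ifs with hi
  · rw [mul_one]
    exact hP _ (by rw [← AddChar.map_nsmul_eq_pow, nsmul_eq_mul, hij hi, AddChar.map_zero_eq_one])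
  · simpa

variable [NeZero d]

theorem AddChar.IsPrimitive.isPrimitiveRoot_one {χ : AddChar (ZMod d) K} (hχ : χ.IsPrimitive) :
    IsPrimitiveRoot (χ 1) d where
  pow_eq_one := by simp [← AddChar.map_nsmul_eq_pow]
  dvd_of_pow_eq_one n hn := by
    rwa [← AddChar.map_nsmul_eq_pow, hχ.zmod_char_eq_one_iff, nsmul_one,
      ZMod.natCast_eq_zero_iff] at hn

theorem exists_eq_mul_of_mul_eq_zero (hN : 0 < N) (hd : d = N * N) {i : ZMod d}
    (hi : (N : ZMod d) * i = 0) : ∃ k < N, i = ((N * k : ℕ) : ZMod d) := by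
  rw [← ZMod.natCast_zmod_val i, ← Nat.cast_mul, ZMod.natCast_eq_zero_iff] at hi
  obtain ⟨k, hk⟩ := Nat.dvd_of_mul_dvd_mul_left hN (Dvd.dvd.trans (dvd_of_eq hd.symm) hi)
  refine ⟨k, ?_, by rw [← hk, ZMod.natCast_zmod_val]⟩
  have := ZMod.val_lt i
  rw [hk] at this
  exact Nat.lt_of_mul_lt_mul_left (this.trans_eq hd)

theorem card_torsion (hN : 0 < N) (hd : d = N * N) :
    #{j : ZMod d | (N : ZMod d) * j = 0} = N := by
  have : ({j : ZMod d | (N : ZMod d) * j = 0} : Finset (ZMod d)) =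
      (range N).image fun k => ((N * k : ℕ) : ZMod d) := by
    ext j
    simp only [mem_filter, mem_univ, true_and, mem_image, mem_range]
    refine ⟨fun h => ?_, ?_⟩
    · obtain ⟨k, hk, rfl⟩ := exists_eq_mul_of_mul_eq_zero hN hd h
      exact ⟨k, hk, rfl⟩
    · rintro ⟨k, -, rfl⟩
      rw [← Nat.cast_mul, ZMod.natCast_eq_zero_iff, hd, ← mul_assoc]
      exact dvd_mul_right _ _
  rw [this, card_image_of_injOn, card_range]
  intro a ha b hb h
  simp only [coe_range, Set.mem_Iio] at ha hb
  have h' := (ZMod.natCast_eq_natCast_iff' _ _ _).1 h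
  rw [Nat.mod_eq_of_lt (by rw [hd]; gcongr), Nat.mod_eq_of_lt (by rw [hd]; gcongr)] at h'
  exact Nat.eq_of_mul_eq_mul_left hN h'

theorem zmodFourier_torsionIndicator (hN : (N : K) ≠ 0) (hd : d = N * N)
    {χ : AddChar (ZMod d) K} (hχ : χ.IsPrimitive) :
    zmodFourier χ (N : K)⁻¹ (torsionIndicator K d N) = torsionIndicator K d N := by
  have hN0 : 0 < N := Nat.pos_of_ne_zero fun h => hN (by simp [h])
  have hNN : (N : ZMod d) * N = 0 := by rw [← Nat.cast_mul, ← hd, ZMod.natCast_self]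
  ext i
  rw [zmodFourier_apply]
  by_cases hi : (N : ZMod d) * i = 0
  · have : ∀ j : ZMod d, χ (i * j) * torsionIndicator K d N j =
        if (N : ZMod d) * j = 0 then 1 else 0 := fun j => by
      unfold torsionIndicator
      split_ifs with hj
      · obtain ⟨k, -, rfl⟩ := exists_eq_mul_of_mul_eq_zero hN0 hd hj
        rw [Nat.cast_mul, ← mul_assoc, mul_comm i, hi]
        simp
      · simp
    simp_rw [this]
    rw [sum_boole, card_torsion hN0 hd, inv_mul_cancel₀ hN, torsionIndicator, if_pos hi]
  · have hχ1 : χ (i * N) ≠ 1 := fun h => hi (by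
      rw [mul_comm]; exact (hχ.zmod_char_eq_one_iff d _).1 h)
    have : ∑ j, χ (i * j) * torsionIndicator K d N j =
        χ (i * N) * ∑ j, χ (i * j) * torsionIndicator K d N j := by
      rw [mul_sum]
      refine (Fintype.sum_equiv (Equiv.addRight (N : ZMod d)) _ _ fun j => ?_).symm
      simp [torsionIndicator, mul_add, hNN, AddChar.map_add_eq_mul, mul_comm (χ (i * N))]
    rw [eq_zero_of_mul_eq_self_left hχ1 this.symm, mul_zero, torsionIndicator, if_neg hi]

theorem isSmallSum_aeval_modulation {P : K[X]} {δ : ℝ} (hδ : 0 ≤ δ)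
    (hP : ∀ μ : K, μ ^ N = 1 → ‖P.eval μ‖ ≤ δ) (χ : AddChar (ZMod d) K) (c : K) :
    IsSmallSum χ c δ (aeval (modulation χ) P (torsionIndicator K d N)) := by
  refine isSmallSum_of_norm_le χ c hδ fun i => ?_
  rw [aeval_modulation_apply]
  exact norm_eval_mul_torsionIndicator_le hδ hP χ id

theorem isSmallSum_aeval_translation (hN : (N : K) ≠ 0) (hd : d = N * N) {P : K[X]} {δ : ℝ}
    (hδ : 0 ≤ δ) (hP : ∀ μ : K, μ ^ N = 1 → ‖P.eval μ‖ ≤ δ) {χ : AddChar (ZMod d) K}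
    (hχ : χ.IsPrimitive) :
    IsSmallSum χ (N : K)⁻¹ δ (aeval (translation K d) P (torsionIndicator K d N)) := by
  refine ⟨0, fun i => by simpa using hδ, fun i => ?_⟩
  rw [sub_zero, zmodFourier_aeval_translation, zmodFourier_torsionIndicator hN hd hχ]
  exact norm_eval_mul_torsionIndicator_le hδ hP χ fun hi => by rw [mul_neg, hi, neg_zero]

end SubgroupIndicator

section SmallSum

open Polynomial Finset

variable {K : Type*} [NormedField K] [IsUltrametricDist K]

theorem isSmallSum_torsionIndicator {p : ℕ} [Fact p.Prime] (hp : ‖(p : K)‖ = (p : ℝ)⁻¹) {ε : ℝ}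
    (hε : 0 < ε) {k : ℕ} (hk : ((p : ℝ)⁻¹) ^ k ≤ ε ^ (p ^ 3 * (p - 1)))
    {χ : AddChar (ZMod (p ^ (2 * (k + 3)))) K} (hχ : χ.IsPrimitive) :
    IsSmallSum χ ((p ^ (k + 3) : ℕ) : K)⁻¹ ε
      (torsionIndicator K (p ^ (2 * (k + 3))) (p ^ (k + 3))) := by
  have hpp : p.Prime := Fact.out
  have hp2 := hpp.two_le
  have hd : p ^ (2 * (k + 3)) = p ^ (k + 3) * p ^ (k + 3) := by ring
  have hζ := hχ.isPrimitiveRoot_one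
  have hN : ((p ^ (k + 3) : ℕ) : K) ≠ 0 := by
    rw [Nat.cast_pow]
    refine pow_ne_zero _ (norm_ne_zero_iff.1 ?_)
    rw [hp]
    exact inv_ne_zero (Nat.cast_ne_zero.2 hpp.ne_zero)
  set ζ := χ 1
  set q := ζ ^ p ^ (k + 3) with hq
  set τ := ζ ^ (p ^ (k + 1) * p ^ (k + 1)) with hτ
  have hqprim : IsPrimitiveRoot q (p ^ (k + 3)) := hζ.pow (NeZero.pos _) hd
  have hτprim : IsPrimitiveRoot τ (p ^ (3 + 1)) := hζ.pow (NeZero.pos _) (by ring)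
  have hq1 : ‖q‖ = 1 := hqprim.norm_eq_one_of_neZero
  have hτp : q ^ p ^ k = τ ^ p ^ 1 := by rw [hq, hτ, ← pow_mul, ← pow_mul]; congr 1; ring
  have hτp2 : q ^ p ^ (k + 1) = τ ^ p ^ 2 := by rw [hq, hτ, ← pow_mul, ← pow_mul]; congr 1; ring
  have hτ1 : ‖1 - τ ^ p ^ 1‖ = ‖1 - τ‖ ^ p := by
    simpa using IsPrimitiveRoot.norm_one_sub_pow_prime_pow (s := 2) (n := 1) hτprim
  have hτ2 : ‖1 - τ ^ p ^ 2‖ = ‖1 - τ‖ ^ p ^ 2 :=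
    IsPrimitiveRoot.norm_one_sub_pow_prime_pow (s := 1) (n := 2) hτprim
  have hτtot := hτprim.norm_one_sub_pow_totient
  rw [hp] at hτtot
  set l := ‖1 - τ‖ with hl
  have he : p ^ 3 * (p - 1) ≠ 0 := mul_ne_zero (NeZero.ne _) (by omega)
  have hl1 : l < 1 := by
    by_contra! h
    have := one_le_pow₀ h (n := p ^ 3 * (p - 1))
    rw [hτtot] at this
    exact this.not_gt (inv_lt_one_of_one_lt₀ (by exact_mod_cast hpp.one_lt))
  have hl0 : 0 < l := by
    refine (norm_nonneg _).lt_of_ne fun h => ?_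
    rw [← hl] at h
    rw [← h, zero_pow he] at hτtot
    exact inv_ne_zero (Nat.cast_ne_zero.2 hpp.ne_zero) hτtot.symm
  have hlk : l ^ k ≤ ε := by
    refine le_of_pow_le_pow_left₀ he hε.le ?_
    rwa [← pow_mul, mul_comm k, pow_mul, hτtot]
  set P : K[X] := ∏ j ∈ range (p ^ (k + 1)), (X - C (q ^ j)) with hPdef
  have hP : ∀ μ : K, μ ^ p ^ (k + 3) = 1 → ‖P.eval μ‖ ≤ (l ^ p) ^ ((p - 1) * (k + 1)) := by
    intro μ hμ
    obtain ⟨x, -, rfl⟩ := hqprim.eq_pow_of_pow_eq_one hμ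
    rw [hPdef, eval_prod, norm_prod]
    simp only [eval_sub, eval_X, eval_C]
    refine prod_norm_pow_sub_pow_le hpp (k + 1) hq1 (fun i hi => ?_) x
    obtain ⟨n, rfl⟩ := Nat.exists_eq_add_of_le (Nat.lt_succ_iff.1 hi)
    have hprim : IsPrimitiveRoot (q ^ p ^ i) (p ^ (2 + n + 1)) :=
      hqprim.pow (NeZero.pos _) (by ring)
    rw [show i + n + 1 - 1 - i = n by omega, ← hprim.norm_one_sub_pow_prime_pow, ← pow_mul,
      ← pow_add, hτp, hτ1]
  have hw : ‖(cyclotomic (p ^ (k + 1)) K).eval q‖ < l := by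
    have h := congrArg (fun Q => ‖Q.eval q‖) (cyclotomic_prime_pow_mul_X_pow_sub_one K p k)
    simp only [eval_mul, eval_sub, eval_pow, eval_X, eval_one, norm_mul] at h
    rw [hτp, hτp2, norm_sub_rev, norm_sub_rev _ (1 : K), hτ1, hτ2] at h
    refine lt_of_mul_lt_mul_right ?_ (pow_nonneg hl0.le p)
    rw [h, ← pow_succ']
    exact pow_lt_pow_right_of_lt_one₀ hl0 hl1 (by nlinarith)
  have hδ : 0 ≤ (l ^ p) ^ ((p - 1) * (k + 1)) := by positivity
  refine (isStableGauge_isSmallSum χ _).iterate_contract (norm_nonneg _)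
    (isSmallSum_of_norm_le χ _ zero_le_one norm_torsionIndicator_le_one)
    (norm_coeff_prod_sub_le hq1.le (NeZero.pos _)) (isSmallSum_aeval_translation hN hd hδ hP hχ)
    (isSmallSum_aeval_modulation hδ hP χ _) hw ?_ (NeZero.pos (p ^ (2 * (k + 3))))
    translation_pow_card (modulation_pow_card χ) hε ?_
  · rw [translation_pow_mul_modulation_pow, ← Nat.cast_mul, ← nsmul_one, AddChar.map_nsmul_eq_pow]
  · rw [← pow_mul]
    calc l ^ (p * ((p - 1) * (k + 1))) ≤ l ^ (k + 1) := by
          refine pow_le_pow_of_le_one hl0.le hl1.le ?_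
          rw [← mul_assoc]
          exact Nat.le_mul_of_pos_left _ (Nat.mul_pos hpp.pos (by omega))
      _ ≤ ε * l := by
          rw [pow_succ]
          exact mul_le_mul_of_nonneg_right hlk hl0.le

theorem exists_isSmallSum_torsionIndicator {p : ℕ} [Fact p.Prime] (hp : ‖(p : K)‖ = (p : ℝ)⁻¹)
    {ε : ℝ} (hε : 0 < ε) :
    ∃ r₀ : ℕ, ∀ r : ℕ, r₀ ≤ r → ∀ χ : AddChar (ZMod (p ^ (2 * r))) K, χ.IsPrimitive →
      IsSmallSum χ ((p ^ r : ℕ) : K)⁻¹ ε (torsionIndicator K (p ^ (2 * r)) (p ^ r)) := by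
  have hp1 : (p : ℝ)⁻¹ < 1 :=
    inv_lt_one_of_one_lt₀ (by exact_mod_cast (Fact.out : p.Prime).one_lt)
  obtain ⟨k₀, hk₀⟩ := exists_pow_lt_of_lt_one (pow_pos hε (p ^ 3 * (p - 1))) hp1
  refine ⟨k₀ + 3, fun r hr χ hχ => ?_⟩
  obtain ⟨k, rfl⟩ := Nat.exists_eq_add_of_le' (le_of_add_le_right hr)
  refine isSmallSum_torsionIndicator hp hε (le_trans ?_ hk₀.le) hχ
  exact pow_le_pow_of_le_one (by positivity) hp1.le (by omega)

end SmallSum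

theorem ZMod.sum_fin_natCast {M : Type*} [AddCommMonoid M] (d : ℕ) [NeZero d] (f : ZMod d → M) :
    ∑ j : Fin d, f (j : ℕ) = ∑ j, f j := by
  refine Function.Bijective.sum_comp (e := fun j : Fin d => ((j : ℕ) : ZMod d)) ?_ f
  refine (Fintype.bijective_iff_injective_and_card _).2 ⟨fun a b h => Fin.ext ?_, by simp⟩
  have := (ZMod.natCast_eq_natCast_iff' _ _ _).1 h
  rwa [Nat.mod_eq_of_lt a.2, Nat.mod_eq_of_lt b.2] at this

theorem exists_approx_dvd_indicator {K : Type*} [NormedField K] [IsUltrametricDist K] {p : ℕ}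
    [Fact p.Prime] (hp : ‖(p : K)‖ = (p : ℝ)⁻¹) {ε : ℝ} (hε : 0 < ε) :
    ∃ r₀ : ℕ, ∀ r : ℕ, r₀ ≤ r → ∀ ζ : K, IsPrimitiveRoot ζ (p ^ (2 * r)) →
      ∃ x : Fin (p ^ (2 * r)) → K,
        (∀ i : Fin (p ^ (2 * r)), ‖x i - (if p ^ r ∣ (i : ℕ) then 1 else 0)‖ ≤ ε) ∧
        (∀ i : Fin (p ^ (2 * r)), ‖(p : K) ^ (-(r : ℤ)) *
          ∑ j : Fin (p ^ (2 * r)), ζ ^ ((i : ℕ) * (j : ℕ)) * x j‖ ≤ ε) := by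
  obtain ⟨r₀, h⟩ := exists_isSmallSum_torsionIndicator hp hε
  refine ⟨r₀, fun r hr ζ hζ => ?_⟩
  obtain ⟨g, hg, hF⟩ := h r hr _ (AddChar.zmodChar_primitive_of_primitive_root _ hζ)
  set J := torsionIndicator K (p ^ (2 * r)) (p ^ r) with hJ
  refine ⟨fun i => (J - g) (i : ℕ), fun i => ?_, fun i => ?_⟩
  · have hJi : J ((i : ℕ) : ZMod (p ^ (2 * r))) = if p ^ r ∣ (i : ℕ) then 1 else 0 :=
      torsionIndicator_natCast (NeZero.pos _) (by ring) _
    beta_reduce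
    rw [Pi.sub_apply, hJi, sub_sub_cancel_left, norm_neg]
    exact hg _
  · have := hF (i : ℕ)
    rw [zmodFourier_apply, ← ZMod.sum_fin_natCast] at this
    simp only [← Nat.cast_mul, AddChar.zmodChar_apply'] at this
    rwa [zpow_neg, zpow_natCast, ← Nat.cast_pow]

/-- **Finite-level approximation** (Ophir–de Shalit, reformulation of Theorem 1 for
`φ₀ = 1_{ℤ_p}`): for every `ε > 0`, for all sufficiently large `r`, with `d = p^{2r}`,
`ζ ∈ K` a primitive `d`-th root of unity and `J` the coordinate vector of `1_{ℤ_p}`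
(`J_i = 1` iff `p^r ∣ i`), there is `x ∈ K^d` with `‖x − J‖_sup ≤ ε` and
`‖p^{-r}·Z x‖_sup ≤ ε`, where `Z = (ζ^{ij})`. -/
theorem stmt_1 (p : ℕ) [Fact p.Prime] (K : Type*) [Field K] [Algebra ℚ_[p] K]
    [IsAlgClosure ℚ_[p] K] (v : AbsoluteValue K ℝ)
    (hv : ∀ x : ℚ_[p], v (algebraMap ℚ_[p] K x) = ‖x‖)
    (ε : ℝ) (hε : 0 < ε) :
    ∃ r₀ : ℕ, ∀ r : ℕ, r₀ ≤ r → ∀ ζ : K, IsPrimitiveRoot ζ (p ^ (2 * r)) →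
      ∃ x : Fin (p ^ (2 * r)) → K,
        (∀ i : Fin (p ^ (2 * r)),
            v (x i - (if p ^ r ∣ (i : ℕ) then 1 else 0)) ≤ ε) ∧
        (∀ i : Fin (p ^ (2 * r)),
            v ((p : K) ^ (-(r : ℤ)) *
                ∑ j : Fin (p ^ (2 * r)), ζ ^ ((i : ℕ) * (j : ℕ)) * x j) ≤ ε) := by
  let := v.toNormedField
  have hK : ∀ n : ℕ, ‖(n : K)‖ = ‖(n : ℚ_[p])‖ := fun n => by
    rw [← hv, map_natCast]
    rfl
  have : IsUltrametricDist K :=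
    IsUltrametricDist.isUltrametricDist_of_forall_norm_natCast_le_one fun n =>
      (hK n).trans_le (IsUltrametricDist.norm_natCast_le_one _ n)
  exact exists_approx_dvd_indicator ((hK p).trans Padic.norm_p) hε
end

section
/- Let p and ℓ be distinct primes and let K be an algebraic closure of ℚ_ℓ equipped with its unique absolute value |·| extending the ℓ-adic absolute value. Let ψ : ℚ_p → Kˣ be an additive character trivial on ℤ_p and nontrivial on p⁻¹ℤ_p. Then for every Schwartz function φ : ℚ_p → K one has sup_{x∈ℚ_p} |F(φ)(x)| = sup_{x∈ℚ_p} |φ(x)|; that is, the ℓ-adic Fourier transform is a sup-norm isometry on Schwartz functions. -/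
/-- An absolute value bounded by `1` on the natural numbers is nonarchimedean. -/
theorem AbsoluteValue.add_le_max_of_natCast_le_one {K : Type*} [Field K] (v : AbsoluteValue K ℝ)
    (h : ∀ n : ℕ, v n ≤ 1) (x y : K) : v (x + y) ≤ max (v x) (v y) := by
  have hn (n : ℕ) : ‖(n : WithAbs v)‖ ≤ 1 := h n
  have := IsUltrametricDist.isUltrametricDist_of_forall_norm_natCast_le_one hn
  exact IsUltrametricDist.norm_add_le_max (WithAbs.toAbs v x) (WithAbs.toAbs v y)

/-- A nonarchimedean absolute value of a sum is bounded by any bound on its terms. -/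
theorem AbsoluteValue.sum_le_of_forall_le {K ι : Type*} [Field K] (v : AbsoluteValue K ℝ)
    (h : ∀ x y : K, v (x + y) ≤ max (v x) (v y)) {B : ℝ} (hB : 0 ≤ B) (s : Finset ι) (f : ι → K)
    (hf : ∀ i ∈ s, v (f i) ≤ B) : v (∑ i ∈ s, f i) ≤ B :=
  Finset.sum_induction f (fun x ↦ v x ≤ B) (fun x y hx hy ↦ (h x y).trans (max_le hx hy))
    (by simpa using hB) hf

/-- Every point of `p^{-m}ℤ_p` is congruent modulo `p^mℤ_p` to some `i / p^m` with `i < p^{2m}`. -/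
theorem Padic.exists_natCast_div_pow_sub_norm_le {p : ℕ} [Fact p.Prime] (m n : ℕ) (x : ℚ_[p])
    (hx : ‖x‖ ≤ (p : ℝ) ^ m) :
    ∃ i < p ^ (m + n), ‖x - (i : ℚ_[p]) / (p : ℚ_[p]) ^ m‖ ≤ (p : ℝ) ^ (-(n : ℤ)) := by
  have hp : (p : ℚ_[p]) ≠ 0 := Nat.cast_ne_zero.2 (Fact.out : p.Prime).ne_zero
  have hp' : (0 : ℝ) < p := Nat.cast_pos.2 (Fact.out : p.Prime).pos
  have hz : ‖x * (p : ℚ_[p]) ^ m‖ ≤ 1 := by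
    rw [norm_mul, norm_pow, Padic.norm_p, inv_pow, ← div_eq_mul_inv]
    exact div_le_one_of_le₀ hx (by positivity)
  let z : ℤ_[p] := ⟨x * (p : ℚ_[p]) ^ m, hz⟩
  refine ⟨z.appr (m + n), z.appr_lt _, ?_⟩
  have h := (PadicInt.norm_le_pow_iff_mem_span_pow _ _).2 (z.appr_spec (m + n))
  rw [PadicInt.norm_def] at h
  push_cast at h
  have e : x - (z.appr (m + n) : ℚ_[p]) / (p : ℚ_[p]) ^ m
      = ((z : ℚ_[p]) - z.appr (m + n)) / (p : ℚ_[p]) ^ m := by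
    change _ = (x * (p : ℚ_[p]) ^ m - _) / _
    field_simp
  rw [e, norm_div, norm_pow, Padic.norm_p, inv_pow, div_inv_eq_mul]
  calc _ ≤ (p : ℝ) ^ (-((m : ℤ) + n)) * (p : ℝ) ^ m := by gcongr
    _ = _ := by
      rw [← zpow_natCast, ← zpow_add₀ hp'.ne']
      congr 1
      ring

/-- An additive character trivial on `ℤ_p` but not on `p⁻¹ℤ_p` has conductor exactly `ℤ_p`. -/
theorem AddChar.ne_one_of_one_lt_norm {p : ℕ} [Fact p.Prime] {K : Type*} [Field K]
    (ψ : AddChar ℚ_[p] K) (hψ1 : ∀ x : ℚ_[p], ‖x‖ ≤ 1 → ψ x = 1)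
    (hψ2 : ∃ x : ℚ_[p], ‖x‖ ≤ (p : ℝ) ∧ ψ x ≠ 1) {x : ℚ_[p]} (hx : 1 < ‖x‖) : ψ x ≠ 1 := by
  intro h
  obtain ⟨y, hy, hψy⟩ := hψ2
  have hp' : (0 : ℝ) < p := Nat.cast_pos.2 (Fact.out : p.Prime).pos
  have hx0 : x ≠ 0 := norm_pos_iff.1 (zero_lt_one.trans hx)
  have hxp : (p : ℝ) ≤ ‖x‖ := by
    by_contra! hlt
    have := (Padic.norm_le_pow_iff_norm_lt_pow_add_one x 0).2 (by simpa using hlt)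
    simp at this
    linarith
  obtain ⟨n, hn⟩ := pow_unbounded_of_one_lt ‖x‖
    (Nat.one_lt_cast.2 (Fact.out : p.Prime).one_lt : (1 : ℝ) < p)
  obtain ⟨i, -, hi⟩ := Padic.exists_natCast_div_pow_sub_norm_le 0 n (y / x) (by
    rw [norm_div, pow_zero]
    exact div_le_one_of_le₀ (hy.trans hxp) (norm_nonneg _))
  rw [pow_zero, div_one] at hi
  apply hψy
  have e : y = i • x + (y / x - i) * x := by
    rw [nsmul_eq_mul]; field_simp; ring
  rw [e, AddChar.map_add_eq_mul, AddChar.map_nsmul_eq_pow, h, one_pow, one_mul]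
  apply hψ1
  rw [norm_mul]
  calc _ ≤ (p : ℝ) ^ (-(n : ℤ)) * (p : ℝ) ^ n := by gcongr
    _ = 1 := by simp [hp'.ne']

/-- An additive character of `ℚ_p` trivial on `ℤ_p` takes values of absolute value `1`. -/
theorem AddChar.absoluteValue_apply_eq_one {p : ℕ} [Fact p.Prime] {K : Type*} [Field K]
    (ψ : AddChar ℚ_[p] K) (hψ1 : ∀ x : ℚ_[p], ‖x‖ ≤ 1 → ψ x = 1) (v : AbsoluteValue K ℝ)
    (x : ℚ_[p]) : v (ψ x) = 1 := by
  have hp' : (0 : ℝ) < p := Nat.cast_pos.2 (Fact.out : p.Prime).pos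
  obtain ⟨n, hn⟩ := pow_unbounded_of_one_lt ‖x‖
    (Nat.one_lt_cast.2 (Fact.out : p.Prime).one_lt : (1 : ℝ) < p)
  have h : ψ x ^ p ^ n = 1 := by
    rw [← AddChar.map_nsmul_eq_pow, nsmul_eq_mul]
    apply hψ1
    rw [Nat.cast_pow, norm_mul, norm_pow, Padic.norm_p, inv_pow, inv_mul_eq_div]
    exact div_le_one_of_le₀ hn.le (by positivity)
  refine (pow_eq_one_iff_of_nonneg (v.nonneg _)
    (pow_ne_zero n (Fact.out : p.Prime).ne_zero)).1 ?_
  rw [← map_pow, h, map_one]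

/-- Orthogonality of the characters `j ↦ ψ (j (i - k) / p^n)` of `ℤ / p^n`. -/
theorem AddChar.sum_range_natCast_mul_sub_div {p : ℕ} [Fact p.Prime] {K : Type*} [Field K]
    (ψ : AddChar ℚ_[p] K) (hψ1 : ∀ x : ℚ_[p], ‖x‖ ≤ 1 → ψ x = 1)
    (hψ2 : ∃ x : ℚ_[p], ‖x‖ ≤ (p : ℝ) ∧ ψ x ≠ 1) {n i k : ℕ} (hi : i < p ^ n) (hk : k < p ^ n) :
    ∑ j ∈ Finset.range (p ^ n), ψ (j * (((i : ℚ_[p]) - k) / (p : ℚ_[p]) ^ n))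
      = if i = k then (p : K) ^ n else 0 := by
  have hp : (p : ℚ_[p]) ≠ 0 := Nat.cast_ne_zero.2 (Fact.out : p.Prime).ne_zero
  have hp' : (0 : ℝ) < p := Nat.cast_pos.2 (Fact.out : p.Prime).pos
  split_ifs with hik
  · simp [hik]
  have e : ((i : ℚ_[p]) - k) = ((i - k : ℤ) : ℚ_[p]) := by push_cast; rfl
  set y := ((i : ℚ_[p]) - k) / (p : ℚ_[p]) ^ n with hy
  have hψy : ψ y ≠ 1 := by
    refine ψ.ne_one_of_one_lt_norm hψ1 hψ2 ?_
    by_contra! hle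
    have hdvd : ((p : ℤ) ^ n) ∣ (i - k : ℤ) := by
      rw [← Padic.norm_int_le_pow_iff_dvd, ← e]
      rw [hy, norm_div, norm_pow, Padic.norm_p, inv_pow, div_inv_eq_mul] at hle
      rw [zpow_neg, zpow_natCast]
      exact (le_inv_mul_iff₀ (by positivity)).2 (by linarith) |>.trans_eq (mul_one _)
    have hik' : (i - k : ℤ) = 0 := by
      refine Int.eq_zero_of_abs_lt_dvd hdvd ?_
      have hi' : (i : ℤ) < (p : ℤ) ^ n := by exact_mod_cast hi
      have hk' : (k : ℤ) < (p : ℤ) ^ n := by exact_mod_cast hk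
      rw [abs_lt]
      constructor <;> linarith [Int.natCast_nonneg i, Int.natCast_nonneg k]
    omega
  have hgeom := mul_neg_geom_sum (ψ y) (p ^ n)
  have hpow : ψ y ^ p ^ n = 1 := by
    rw [← AddChar.map_nsmul_eq_pow, nsmul_eq_mul]
    apply hψ1
    have e2 : ((p ^ n : ℕ) : ℚ_[p]) * y = ((i - k : ℤ) : ℚ_[p]) := by
      rw [← e, hy]; push_cast; field_simp
    rw [e2]
    exact Padic.norm_int_le_one _
  rw [hpow, sub_self] at hgeom
  have := (mul_eq_zero.1 hgeom).resolve_left (sub_ne_zero.2 hψy.symm)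
  simpa [← nsmul_eq_mul, AddChar.map_nsmul_eq_pow] using this


/-- **The `ℓ`-adic Fourier transform is a sup-norm isometry** (Ophir–de Shalit, §3.2).
`K` is an algebraic closure of `ℚ_ℓ` (`ℓ ≠ p`) with its unique absolute value `v` extending the
`ℓ`-adic one, `ψ : ℚ_p → Kˣ` an additive character trivial on `ℤ_p` and nontrivial on `p⁻¹ℤ_p`.
For every Schwartz function `φ : ℚ_p → K` and every admissible level `m` (i.e. `φ` is supported
in `p^{-m}ℤ_p` and constant on cosets of `p^mℤ_p`), the Fourier transform
`F(φ)(x) = p^{-m} ∑_{i<p^{2m}} φ(i/p^m) ψ(x·(i/p^m))` has the same sup norm as `φ`. -/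
theorem stmt_3 (p l : ℕ) [Fact p.Prime] [Fact l.Prime] (hpl : p ≠ l)
    (K : Type*) [Field K] [Algebra ℚ_[l] K] [IsAlgClosure ℚ_[l] K]
    (v : AbsoluteValue K ℝ)
    (hv : ∀ x : ℚ_[l], v (algebraMap ℚ_[l] K x) = ‖x‖)
    (ψ : AddChar ℚ_[p] K)
    (hψ1 : ∀ x : ℚ_[p], ‖x‖ ≤ 1 → ψ x = 1)
    (hψ2 : ∃ x : ℚ_[p], ‖x‖ ≤ (p : ℝ) ∧ ψ x ≠ 1)
    (φ : ℚ_[p] → K) (hφlc : IsLocallyConstant φ) (hφcs : HasCompactSupport φ) :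
    ∀ m : ℕ,
      (∀ x : ℚ_[p], φ x ≠ 0 → ‖x‖ ≤ (p : ℝ) ^ m) →
      (∀ x y : ℚ_[p], ‖y‖ ≤ (p : ℝ) ^ (-(m : ℤ)) → φ (x + y) = φ x) →
      (⨆ x : ℚ_[p],
          v ((p : K) ^ (-(m : ℤ)) *
              ∑ i ∈ Finset.range (p ^ (2 * m)),
                φ ((i : ℚ_[p]) / (p : ℚ_[p]) ^ m) * ψ (x * ((i : ℚ_[p]) / (p : ℚ_[p]) ^ m))))
        = ⨆ x : ℚ_[p], v (φ x) := by
  intro m hsupp hconst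
  have hp : (p : ℚ_[p]) ≠ 0 := Nat.cast_ne_zero.2 (Fact.out : p.Prime).ne_zero
  have hvnat (n : ℕ) : v n = ‖(n : ℚ_[l])‖ := by rw [← hv, map_natCast (algebraMap ℚ_[l] K)]
  have hvp : v (p : K) = 1 := by
    rw [hvnat, Padic.norm_natCast_eq_one_iff]
    exact (Nat.coprime_primes (Fact.out : l.Prime) (Fact.out : p.Prime)).2 hpl.symm
  have hpK : (p : K) ≠ 0 := v.ne_zero_iff.1 (by rw [hvp]; exact one_ne_zero)
  have hna := v.add_le_max_of_natCast_le_one fun n ↦ by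
    rw [hvnat]; exact_mod_cast Padic.norm_int_le_one (n : ℤ)
  have hvψ := ψ.absoluteValue_apply_eq_one hψ1 v
  have hvpm : v ((p : K) ^ (-(m : ℤ))) = 1 := by simp [hvp]
  have hrep (x : ℚ_[p]) (hx : φ x ≠ 0) :
      ∃ i < p ^ (2 * m), φ ((i : ℚ_[p]) / (p : ℚ_[p]) ^ m) = φ x := by
    obtain ⟨i, hi, hxi⟩ := Padic.exists_natCast_div_pow_sub_norm_le m m x (hsupp x hx)
    refine ⟨i, two_mul m ▸ hi, ?_⟩
    simpa using (hconst ((i : ℚ_[p]) / (p : ℚ_[p]) ^ m) _ hxi).symm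
  have hφbdd : BddAbove (Set.range fun x ↦ v (φ x)) := by
    obtain ⟨B, hB⟩ := ((Finset.range (p ^ (2 * m))).image
      fun i : ℕ ↦ v (φ ((i : ℚ_[p]) / (p : ℚ_[p]) ^ m))).bddAbove
    refine ⟨max B 0, ?_⟩
    rintro _ ⟨x, rfl⟩
    by_cases hx : φ x = 0
    · simp [hx]
    · obtain ⟨i, hi, h⟩ := hrep x hx
      refine le_max_of_le_left (hB ?_)
      simp only [Finset.coe_image, Set.mem_image]
      exact ⟨i, by simpa using hi, by rw [h]⟩
  have hφ0 : 0 ≤ ⨆ x, v (φ x) := Real.iSup_nonneg fun _ ↦ v.nonneg _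
  set F : ℚ_[p] → K := fun x ↦ (p : K) ^ (-(m : ℤ)) * ∑ i ∈ Finset.range (p ^ (2 * m)),
    φ ((i : ℚ_[p]) / (p : ℚ_[p]) ^ m) * ψ (x * ((i : ℚ_[p]) / (p : ℚ_[p]) ^ m)) with hF
  change ⨆ x, v (F x) = _
  have hFle (x : ℚ_[p]) : v (F x) ≤ ⨆ x, v (φ x) := by
    rw [hF, map_mul, hvpm, one_mul]
    refine v.sum_le_of_forall_le hna hφ0 _ _ fun i _ ↦ ?_
    rw [map_mul, hvψ, mul_one]
    exact le_ciSup hφbdd _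
  have hFbdd : BddAbove (Set.range fun x ↦ v (F x)) := ⟨_, Set.forall_mem_range.2 hFle⟩
  have hF0 : 0 ≤ ⨆ x, v (F x) := Real.iSup_nonneg fun _ ↦ v.nonneg _
  refine le_antisymm (ciSup_le hFle) (ciSup_le fun x ↦ ?_)
  by_cases hx : φ x = 0
  · simpa [hx] using hF0
  obtain ⟨k, hk, hkx⟩ := hrep x hx
  have hinv : ∑ j ∈ Finset.range (p ^ (2 * m)),
      F ((j : ℚ_[p]) / (p : ℚ_[p]) ^ m) * ψ (-(j * (k / (p : ℚ_[p]) ^ (2 * m))))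
        = (p : K) ^ m * φ x := by
    have hterm (i j : ℕ) : ψ ((j : ℚ_[p]) / (p : ℚ_[p]) ^ m * ((i : ℚ_[p]) / (p : ℚ_[p]) ^ m)) *
        ψ (-(j * (k / (p : ℚ_[p]) ^ (2 * m))))
          = ψ (j * (((i : ℚ_[p]) - k) / (p : ℚ_[p]) ^ (2 * m))) := by
      rw [← AddChar.map_add_eq_mul]
      congr 1
      field_simp
      ring
    simp only [hF, mul_assoc, Finset.sum_mul, hterm]
    rw [← Finset.mul_sum, Finset.sum_comm]
    simp only [← Finset.mul_sum]
    rw [Finset.sum_congr rfl fun i hi ↦ by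
      rw [ψ.sum_range_natCast_mul_sub_div hψ1 hψ2 (Finset.mem_range.1 hi) hk]]
    simp only [mul_ite, mul_zero, Finset.sum_ite_eq', Finset.mem_range, hk, if_true, hkx]
    rw [zpow_neg, zpow_natCast]
    field_simp
    ring
  have hval : v (φ x) = v ((p : K) ^ m * φ x) := by simp [hvp]
  rw [hval, ← hinv]
  refine v.sum_le_of_forall_le hna hF0 _ _ fun j _ ↦ ?_
  rw [map_mul, hvψ, mul_one]
  exact le_ciSup hFbdd _
end

section
/- Let p be a prime, r ≥ 1, and 0 ≤ n ≤ p^{2r} − 1. Let C be a field of characteristic 0 containing a primitive p^r-th root of unity μ. Then, as an identity of Laurent polynomials in C[q, q⁻¹], p^r · Ω_{r,n}(q) = Σ_{j=0}^{p^r − 1} ∏_{l=0}^{n−1} (1 − q^{-l} μ^j); that is, Ω_{r,n}(q) = (1/p^r) Σ_{η^{p^r}=1} ∏_{l=0}^{n−1} (1 − q^{-l} η), the sum over all p^r-th roots of unity η in C. -/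
/-- The `q`-Pochhammer symbol `(q;q)_n = ∏_{k=1}^n (1 - q^k)` in `ℤ[q]`. -/
noncomputable def qPoch (n : ℕ) : Polynomial ℤ :=
  ∏ i ∈ Finset.range n, (1 - Polynomial.X ^ (i + 1))

theorem qPoch_succ (n : ℕ) : qPoch (n + 1) = qPoch n * (1 - Polynomial.X ^ (n + 1)) :=
  Finset.prod_range_succ _ _

theorem qPoch_zero : qPoch 0 = 1 := rfl

theorem qPoch_ne_zero (n : ℕ) : qPoch n ≠ 0 := by
  refine Finset.prod_ne_zero_iff.2 fun i _ h => ?_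
  simpa using congrArg (Polynomial.eval 0) h

theorem qBinom_zero {B : ℕ → ℕ → Polynomial ℤ}
    (hB1 : ∀ n k : ℕ, k ≤ n → B n k * (qPoch k * qPoch (n - k)) = qPoch n) (n : ℕ) :
    B n 0 = 1 :=
  mul_right_cancel₀ (qPoch_ne_zero n) (by simpa [qPoch_zero] using hB1 n 0 n.zero_le)

theorem qBinom_self {B : ℕ → ℕ → Polynomial ℤ}
    (hB1 : ∀ n k : ℕ, k ≤ n → B n k * (qPoch k * qPoch (n - k)) = qPoch n) (n : ℕ) :
    B n n = 1 :=
  mul_right_cancel₀ (qPoch_ne_zero n) (by simpa [qPoch_zero] using hB1 n n le_rfl)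

/-- The `q`-Pascal recurrence for any family satisfying the defining equations of the Gaussian
binomial coefficients. -/
theorem qPascal {B : ℕ → ℕ → Polynomial ℤ} (hB0 : ∀ n k : ℕ, n < k → B n k = 0)
    (hB1 : ∀ n k : ℕ, k ≤ n → B n k * (qPoch k * qPoch (n - k)) = qPoch n) (n k : ℕ) :
    B (n + 1) (k + 1) = Polynomial.X ^ (k + 1) * B n (k + 1) + B n k := by
  rcases lt_trichotomy n k with h | rfl | h
  · simp [hB0 _ _ h, hB0 n (k + 1) (by omega), hB0 (n + 1) (k + 1) (by omega)]
  · simp [hB0 n (n + 1) (by omega), qBinom_self hB1]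
  · obtain ⟨m, rfl⟩ : ∃ m, n = k + m + 1 := ⟨n - k - 1, by omega⟩
    have h1 := hB1 (k + m + 1 + 1) (k + 1) (by omega)
    have h2 := hB1 (k + m + 1) (k + 1) (by omega)
    have h3 := hB1 (k + m + 1) k (by omega)
    rw [show k + m + 1 + 1 - (k + 1) = m + 1 by omega, qPoch_succ (k + m + 1)] at h1
    rw [show k + m + 1 - (k + 1) = m by omega] at h2
    rw [show k + m + 1 - k = m + 1 by omega] at h3
    apply mul_right_cancel₀ (mul_ne_zero (qPoch_ne_zero (k + 1)) (qPoch_ne_zero (m + 1)))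
    rw [h1]
    rw [qPoch_succ k, qPoch_succ m] at *
    linear_combination (-Polynomial.X ^ (k + 1) * (1 - Polynomial.X ^ (m + 1))) * h2 -
      (1 - Polynomial.X ^ (k + 1)) * h3

open LaurentPolynomial in
/-- The finite `q`-binomial theorem, with `q⁻¹` as base of the product. -/
theorem prod_one_sub_T_neg_mul {R : Type*} [CommRing R] {B : ℕ → ℕ → Polynomial ℤ}
    (hB0 : ∀ n k : ℕ, n < k → B n k = 0)
    (hB1 : ∀ n k : ℕ, k ≤ n → B n k * (qPoch k * qPoch (n - k)) = qPoch n) (n : ℕ)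
    (x : LaurentPolynomial R) :
    ∏ l ∈ Finset.range n, (1 - T (-(l : ℤ)) * x) =
      ∑ k ∈ Finset.range (n + 1), (-1) ^ k * T (((k + 1).choose 2 : ℤ) - (n * k : ℤ)) *
        Polynomial.toLaurent ((B n k).map (Int.castRingHom R)) * x ^ k := by
  induction n with
  | zero => simp [qBinom_zero hB1]
  | succ n ih =>
    have hstep (k : ℕ) :
        (-1) ^ (k + 1) * T (((k + 1 + 1).choose 2 : ℤ) - ((n + 1 : ℕ) * (k + 1 : ℕ) : ℤ)) *
          Polynomial.toLaurent ((B (n + 1) (k + 1)).map (Int.castRingHom R)) * x ^ (k + 1) =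
        (-1) ^ (k + 1) * T (((k + 1 + 1).choose 2 : ℤ) - (n * (k + 1 : ℕ) : ℤ)) *
          Polynomial.toLaurent ((B n (k + 1)).map (Int.castRingHom R)) * x ^ (k + 1) -
        (-1) ^ k * T (((k + 1).choose 2 : ℤ) - (n * k : ℤ)) *
          Polynomial.toLaurent ((B n k).map (Int.castRingHom R)) * x ^ k *
            (T (-(n : ℤ)) * x) := by
      have hc : (k + 1 + 1).choose 2 = (k + 1) + (k + 1).choose 2 := by
        rw [Nat.choose_succ_succ' (k + 1) 1, Nat.choose_one_right]
      have e1 : (T (((k + 1 + 1).choose 2 : ℤ) - (n * (k + 1 : ℕ) : ℤ)) : R[T;T⁻¹]) =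
          T (((k + 1 + 1).choose 2 : ℤ) - ((n + 1 : ℕ) * (k + 1 : ℕ) : ℤ)) *
            T ((k + 1 : ℕ) : ℤ) := by
        rw [← T_add]; congr 1; push_cast; ring
      have e2 : (T (((k + 1 + 1).choose 2 : ℤ) - ((n + 1 : ℕ) * (k + 1 : ℕ) : ℤ)) : R[T;T⁻¹]) =
          T (((k + 1).choose 2 : ℤ) - (n * k : ℤ)) * T (-(n : ℤ)) := by
        rw [← T_add, hc]; congr 1; push_cast; ring
      rw [qPascal hB0 hB1, e1]
      simp only [Polynomial.map_add, Polynomial.map_mul, Polynomial.map_pow, Polynomial.map_X,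
        map_add, map_mul, Polynomial.toLaurent_X_pow]
      rw [e2]
      ring
    rw [Finset.prod_range_succ, ih, Finset.sum_range_succ' _ (n + 1)]
    simp only [hstep, Finset.sum_sub_distrib, ← Finset.sum_mul]
    have hext := Finset.sum_range_succ' (fun k : ℕ => (-1) ^ k *
      T (((k + 1).choose 2 : ℤ) - (n * k : ℤ)) *
        Polynomial.toLaurent ((B n k).map (Int.castRingHom R)) * x ^ k) (n + 1)
    rw [Finset.sum_range_succ] at hext
    simp only [hB0 n (n + 1) (by omega), Polynomial.map_zero, map_zero, mul_zero, zero_mul,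
      add_zero] at hext
    rw [mul_sub, mul_one]
    nth_rewrite 1 [hext]
    simp [qBinom_zero hB1]
    ring

/-- Orthogonality of the powers of a primitive root of unity. -/
theorem IsPrimitiveRoot.sum_pow_pow {R : Type*} [CommRing R] [IsDomain R] {ζ : R} {d : ℕ}
    (hζ : IsPrimitiveRoot ζ d) (k : ℕ) :
    ∑ j ∈ Finset.range d, (ζ ^ j) ^ k = if d ∣ k then (d : R) else 0 := by
  have hcomm (j : ℕ) : (ζ ^ j) ^ k = (ζ ^ k) ^ j := pow_right_comm ζ j k
  simp only [hcomm]
  split_ifs with h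
  · simp [(hζ.pow_eq_one_iff_dvd k).2 h]
  · have h1 : ζ ^ k - 1 ≠ 0 := sub_ne_zero.2 fun h1 => h ((hζ.pow_eq_one_iff_dvd k).1 h1)
    have h2 := geom_sum_mul (ζ ^ k) d
    rw [pow_right_comm, hζ.pow_eq_one, one_pow, sub_self] at h2
    exact (mul_eq_zero.1 h2).resolve_right h1

theorem Finset.sum_range_ite_dvd {M : Type*} [AddCommMonoid M] {d : ℕ} (hd : 0 < d) (n : ℕ)
    (f : ℕ → M) :
    ∑ k ∈ Finset.range (n + 1), (if d ∣ k then f k else 0) =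
      ∑ k ∈ Finset.range (n / d + 1), f (k * d) := by
  rw [← Finset.sum_filter]
  symm
  refine Finset.sum_nbij (· * d) ?_ ?_ ?_ fun _ _ => rfl
  · intro k hk
    simp only [Finset.mem_range, Nat.lt_succ_iff, Finset.mem_filter] at hk ⊢
    exact ⟨(Nat.le_div_iff_mul_le hd).1 hk, Dvd.intro_left k rfl⟩
  · exact fun a _ b _ h => Nat.eq_of_mul_eq_mul_right hd h
  · intro k hk
    simp only [Finset.coe_filter, Finset.mem_range, Nat.lt_succ_iff, Set.mem_ofPred_eq] at hk
    obtain ⟨hk, m, rfl⟩ := hk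
    refine ⟨m, ?_, mul_comm _ _⟩
    simp only [Finset.coe_range, Set.mem_Iio, Nat.lt_succ_iff]
    exact (Nat.le_div_iff_mul_le hd).2 (by rwa [mul_comm])

/-- **Root-of-unity average formula for `Ω_{r,n}(q)`** (Ophir–de Shalit, Lemma 4):
in the ring of Laurent polynomials over a characteristic-zero field `C` containing a primitive
`p^r`-th root of unity `μ`,
`p^r · Ω_{r,n}(q) = Σ_{η^{p^r}=1} ∏_{l=0}^{n−1} (1 − q^{-l} η) = Σ_{j=0}^{p^r−1} ∏_{l=0}^{n−1} (1 − q^{-l} μ^j)`,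
where `Ω_{r,n}(q) = Σ_{k=0}^{⌊n/p^r⌋} (−1)^{k p^r} q^{(kp^r)(kp^r+1)/2 − n k p^r} [n choose kp^r]_q`.
Here `B` is the Gaussian binomial coefficient `[n choose k]_q ∈ ℤ[q]`, characterized by
`[n choose k]_q (q;q)_k (q;q)_{n−k} = (q;q)_n` for `k ≤ n` and `[n choose k]_q = 0` for `k > n`. -/
theorem stmt_5 (p : ℕ) (hp : p.Prime) (r : ℕ) (hr : 1 ≤ r) (n : ℕ) (hn : n ≤ p ^ (2 * r) - 1)
    (C : Type*) [Field C] [CharZero C] (μ : C) (hμ : IsPrimitiveRoot μ (p ^ r))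
    (B : ℕ → ℕ → Polynomial ℤ)
    (hB0 : ∀ n k : ℕ, n < k → B n k = 0)
    (hB1 : ∀ n k : ℕ, k ≤ n → B n k * (qPoch k * qPoch (n - k)) = qPoch n) :
    (p : LaurentPolynomial C) ^ r *
        ∑ k ∈ Finset.range (n / p ^ r + 1),
          (-1) ^ (k * p ^ r) *
            LaurentPolynomial.T (((k * p ^ r + 1).choose 2 : ℤ) - (n * k * p ^ r : ℤ)) *
            Polynomial.toLaurent ((B n (k * p ^ r)).map (Int.castRingHom C))
      = ∑ j ∈ Finset.range (p ^ r),
          ∏ l ∈ Finset.range n,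
            (1 - LaurentPolynomial.T (-(l : ℤ)) * LaurentPolynomial.C (μ ^ j)) := by
  have hd : 0 < p ^ r := pow_pos hp.pos r
  simp only [prod_one_sub_T_neg_mul hB0 hB1]
  rw [Finset.sum_comm]
  simp only [← Finset.mul_sum, ← map_pow]
  simp only [← map_sum, hμ.sum_pow_pow, apply_ite LaurentPolynomial.C, map_zero, mul_ite, mul_zero]
  rw [Finset.sum_range_ite_dvd hd, Finset.mul_sum]
  refine Finset.sum_congr rfl fun k _ => ?_
  simp only [map_natCast]
  push_cast
  rw [mul_comm, mul_assoc (n : ℤ)]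
end

section
/- (q-binomial inversion.) For all integers n, m ≥ 0, in ℤ[q] one has Σ_{k=0}^{n} (−1)^{n−k} q^{(n−k)(n−k−1)/2} [n choose k]_q [k choose m]_q = δ_{n,m}, where δ_{n,m} = 1 if n = m and 0 otherwise. Equivalently, the lower-triangular unipotent matrix V with entries V_{n,k} = (−1)^{n−k} q^{(n−k)(n−k−1)/2} [n choose k]_q (0 ≤ k ≤ n) is the inverse of the transpose of the upper-triangular unipotent matrix U with entries U_{n,k} = [k choose n]_q (0 ≤ n ≤ k). -/
section GaussianBinomial

open Polynomial

variable {B : ℕ → ℕ → ℤ[X]}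

theorem gaussBinom_zero_right
    (hB1 : ∀ n k : ℕ, k ≤ n → B n k * (qPoch k * qPoch (n - k)) = qPoch n) (n : ℕ) :
    B n 0 = 1 := by
  have h := hB1 n 0 n.zero_le
  rw [qPoch_zero, one_mul, Nat.sub_zero] at h
  exact (mul_eq_right₀ (qPoch_ne_zero n)).mp h

theorem gaussBinom_self
    (hB1 : ∀ n k : ℕ, k ≤ n → B n k * (qPoch k * qPoch (n - k)) = qPoch n) (n : ℕ) :
    B n n = 1 := by
  have h := hB1 n n le_rfl
  rw [Nat.sub_self, qPoch_zero, mul_one] at h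
  exact (mul_eq_right₀ (qPoch_ne_zero n)).mp h

/-- The `q`-Pascal recursion. -/
theorem gaussBinom_succ_succ (hB0 : ∀ n k : ℕ, n < k → B n k = 0)
    (hB1 : ∀ n k : ℕ, k ≤ n → B n k * (qPoch k * qPoch (n - k)) = qPoch n) (n k : ℕ) :
    B (n + 1) (k + 1) = B n k + X ^ (k + 1) * B n (k + 1) := by
  rcases lt_trichotomy n k with h | rfl | h
  · rw [hB0 _ _ h, hB0 n (k + 1) (by lia), hB0 (n + 1) (k + 1) (by lia), mul_zero, add_zero]
  · rw [gaussBinom_self hB1, gaussBinom_self hB1, hB0 n (n + 1) (by lia), mul_zero, add_zero]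
  · obtain ⟨d, rfl⟩ := Nat.exists_eq_add_of_lt h
    refine mul_right_cancel₀ (mul_ne_zero (qPoch_ne_zero (k + 1)) (qPoch_ne_zero (d + 1))) ?_
    have h1 := hB1 (k + d + 1 + 1) (k + 1) (by lia)
    have h2 := hB1 (k + d + 1) k (by lia)
    have h3 := hB1 (k + d + 1) (k + 1) (by lia)
    rw [show k + d + 1 + 1 - (k + 1) = d + 1 by lia, qPoch_succ (k + d + 1)] at h1
    rw [show k + d + 1 - k = d + 1 by lia] at h2
    rw [show k + d + 1 - (k + 1) = d by lia] at h3
    rw [h1]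
    rw [qPoch_succ k] at h3 ⊢
    rw [qPoch_succ d] at h2 ⊢
    linear_combination (-(1 - X ^ (k + 1))) * h2 - X ^ (k + 1) * (1 - X ^ (d + 1)) * h3

/-- Trinomial revision, with the lower index of the first factor reflected. -/
theorem gaussBinom_mul_gaussBinom_sub (hB0 : ∀ n k : ℕ, n < k → B n k = 0)
    (hB1 : ∀ n k : ℕ, k ≤ n → B n k * (qPoch k * qPoch (n - k)) = qPoch n)
    {n m j : ℕ} (hm : m ≤ n) (hj : j ≤ n) :
    B n (n - j) * B (n - j) m = B n m * B (n - m) j := by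
  rcases lt_or_ge (n - j) m with h | h
  · rw [hB0 _ _ h, hB0 (n - m) j (by lia), mul_zero, mul_zero]
  · have h1 := hB1 n (n - j) (by lia)
    have h2 := hB1 (n - j) m h
    have h3 := hB1 n m hm
    have h4 := hB1 (n - m) j (by lia)
    rw [show n - (n - j) = j by lia] at h1
    rw [show n - m - j = n - j - m by lia] at h4
    refine mul_right_cancel₀ (mul_ne_zero (mul_ne_zero (qPoch_ne_zero j) (qPoch_ne_zero m))
      (qPoch_ne_zero (n - j - m))) ?_
    linear_combination B n (n - j) * qPoch j * h2 + h1 - B n m * qPoch m * h4 - h3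

/-- Partial alternating sums of a row of Gaussian binomial coefficients. -/
theorem sum_range_succ_neg_one_pow_mul_gaussBinom (hB0 : ∀ n k : ℕ, n < k → B n k = 0)
    (hB1 : ∀ n k : ℕ, k ≤ n → B n k * (qPoch k * qPoch (n - k)) = qPoch n) (n l : ℕ) :
    ∑ j ∈ Finset.range (l + 1), (-1) ^ j * X ^ (j * (j - 1) / 2) * B (n + 1) j
      = (-1) ^ l * X ^ ((l + 1) * l / 2) * B n l := by
  induction l with
  | zero => simp [gaussBinom_zero_right hB1]
  | succ l ih =>
    rw [Finset.sum_range_succ, ih, gaussBinom_succ_succ hB0 hB1, Nat.add_sub_cancel,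
      show (l + 1 + 1) * (l + 1) / 2 = (l + 1) * l / 2 + (l + 1) from Nat.triangle_succ (l + 1)]
    ring

end GaussianBinomial

open Polynomial in
/-- **`q`-binomial inversion** (Ophir–de Shalit, Proposition 5 (i)): in `ℤ[q]`,
`Σ_{k=0}^n (−1)^{n−k} q^{(n−k)(n−k−1)/2} [n choose k]_q [k choose m]_q = δ_{n,m}`.
Here `B` is the Gaussian binomial coefficient `[n choose k]_q ∈ ℤ[q]`, characterized by
`[n choose k]_q (q;q)_k (q;q)_{n−k} = (q;q)_n` for `k ≤ n` and `[n choose k]_q = 0` for `k > n`. -/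
theorem stmt_6 (B : ℕ → ℕ → Polynomial ℤ)
    (hB0 : ∀ n k : ℕ, n < k → B n k = 0)
    (hB1 : ∀ n k : ℕ, k ≤ n → B n k * (qPoch k * qPoch (n - k)) = qPoch n)
    (n m : ℕ) :
    ∑ k ∈ Finset.range (n + 1),
        (-1) ^ (n - k) * (X : ℤ[X]) ^ ((n - k) * (n - k - 1) / 2) * B n k * B k m
      = if n = m then 1 else 0 := by
  rcases lt_or_ge n m with h | h
  · rw [if_neg h.ne]
    refine Finset.sum_eq_zero fun k hk => ?_
    rw [hB0 k m (by grind), mul_zero]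
  have key : ∑ k ∈ Finset.range (n + 1),
        (-1) ^ (n - k) * (X : ℤ[X]) ^ ((n - k) * (n - k - 1) / 2) * B n k * B k m
      = B n m * ∑ j ∈ Finset.range (n + 1), (-1) ^ j * X ^ (j * (j - 1) / 2) * B (n - m) j := by
    rw [← Finset.sum_flip, Finset.mul_sum]
    refine Finset.sum_congr rfl fun j hj => ?_
    have hj' : j ≤ n := Finset.mem_range_succ_iff.mp hj
    rw [Nat.sub_sub_self hj', mul_assoc, gaussBinom_mul_gaussBinom_sub hB0 hB1 h hj']
    ring
  rw [key]
  rcases h.eq_or_lt with rfl | h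
  · rw [if_pos rfl, gaussBinom_self hB1, one_mul, Finset.sum_eq_single 0]
    · simp [gaussBinom_zero_right hB1]
    · intro j _ hj
      rw [hB0 _ j (by lia), mul_zero]
    · simp
  · obtain ⟨d, rfl⟩ := Nat.exists_eq_add_of_lt h
    rw [if_neg h.ne', show m + d + 1 - m = d + 1 by lia,
      sum_range_succ_neg_one_pow_mul_gaussBinom hB0 hB1, hB0 d _ (by lia), mul_zero, mul_zero]
end

section
/- Let p be a prime, r ≥ 1, d = p^{2r}, and let K be an algebraic closure of ℚ_p with its unique absolute value extending the p-adic one. Let ζ ∈ K be a primitive d-th root of unity and let v_p be the valuation on K normalized by v_p(p) = 1. Let 1 ≤ n ≤ d − 1 and write n = Σ_{i=0}^{s} a_i p^i with digits 0 ≤ a_i ≤ p−1. Then v_p(∏_{k=1}^{n} (1 − ζ^k)) = β_p(n) / ((p−1) p^{2r−1}), where β_p(n) = n + ((p−1)/p) Σ_{i=0}^{s} i a_i p^i. Moreover β_p(n) = Σ_{k=0}^{∞} p^k (⌊n/p^k⌋ − ⌊n/p^{k+1}⌋). -/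
open Finset in
/-- `∑ p ^ k (⌊n / p ^ k⌋ - ⌊n / p ^ (k + 1)⌋)` equals `∑ p ^ v_p(m)` over `1 ≤ m ≤ n`. -/
lemma sum_pow_mul_div_sub_div_eq_sum_padicValNat (p : ℕ) [hp : Fact p.Prime] (N n : ℕ)
    (hn : n < p ^ N) :
    ∑ k ∈ range N, (p : ℚ) ^ k * (((n / p ^ k : ℕ) : ℚ) - ((n / p ^ (k + 1) : ℕ) : ℚ))
      = ∑ k ∈ range n, (p : ℚ) ^ padicValNat p (k + 1) := by
  induction n with
  | zero => simp
  | succ n ih =>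
    rw [sum_range_succ _ n, ← ih (by omega), ← sub_eq_iff_eq_add', ← sum_sub_distrib]
    have hdvd : ∀ k, p ^ k ∣ n + 1 ↔ k ≤ padicValNat p (n + 1) := fun k =>
      padicValNat_dvd_iff_le (by omega)
    have hlt : padicValNat p (n + 1) < N := by
      by_contra! h
      exact absurd (Nat.le_of_dvd (by omega) ((hdvd N).2 h)) (by omega)
    rw [sum_eq_single_of_mem (padicValNat p (n + 1)) (mem_range.2 hlt)]
    · simp only [Nat.succ_div, hdvd]
      simp
      ring
    · intro k _ hk
      simp only [Nat.succ_div, hdvd]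
      rcases lt_or_gt_of_ne hk with h | h
      · rw [if_pos h.le, if_pos (Nat.succ_le_of_lt h)]
        push_cast
        ring
      · rw [if_neg (by omega), if_neg (by omega)]
        simp

/-- A sum of `N` base-`p` digits is less than `p ^ N`. -/
lemma sum_digits_lt_pow (p : ℕ) (hp : 1 ≤ p) (a : ℕ → ℕ) (ha : ∀ i, a i ≤ p - 1) (N : ℕ) :
    ∑ i ∈ Finset.range N, a i * p ^ i < p ^ N := by
  induction N with
  | zero => simp
  | succ N ih =>
    rw [Finset.sum_range_succ]
    have h : a N * p ^ N ≤ (p - 1) * p ^ N := Nat.mul_le_mul_right _ (ha N)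
    have h' : (p - 1) * p ^ N + p ^ N = p ^ (N + 1) := by
      rw [← Nat.succ_mul, Nat.succ_eq_add_one, Nat.sub_add_cancel hp, pow_succ']
    omega

open Finset in
/-- `∑ p ^ k (⌊n / p ^ k⌋ - ⌊n / p ^ (k + 1)⌋)` in terms of the base-`p` digits of `n`. -/
lemma sum_pow_mul_div_sub_div_eq_digits (p : ℕ) (hp : 1 ≤ p) (N : ℕ) (a : ℕ → ℕ)
    (ha : ∀ i, a i ≤ p - 1) (n : ℕ) (hn : n = ∑ i ∈ range N, a i * p ^ i) :
    ∑ k ∈ range N, (p : ℚ) ^ k * (((n / p ^ k : ℕ) : ℚ) - ((n / p ^ (k + 1) : ℕ) : ℚ))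
      = n + ((p : ℚ) - 1) / p * ∑ i ∈ range N, (i : ℚ) * a i * p ^ i := by
  induction N generalizing a n with
  | zero => simp [hn]
  | succ N ih =>
    have hp0 : (p : ℚ) ≠ 0 := by positivity
    have hn' : n = p * (∑ i ∈ range N, a (i + 1) * p ^ i) + a 0 := by
      rw [hn, sum_range_succ', mul_sum]
      simp only [pow_succ, pow_zero, mul_one]
      congr 1
      exact sum_congr rfl fun i _ => by ring
    have hdiv : n / p = ∑ i ∈ range N, a (i + 1) * p ^ i := by
      rw [hn', Nat.mul_add_div (by omega), Nat.div_eq_of_lt (by have := ha 0; omega), add_zero]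
    have h := ih (fun i => a (i + 1)) (fun i => ha _) (n / p) hdiv
    rw [sum_range_succ', sum_range_succ']
    have hL : ∑ k ∈ range N, (p : ℚ) ^ (k + 1) *
        (((n / p ^ (k + 1) : ℕ) : ℚ) - ((n / p ^ (k + 1 + 1) : ℕ) : ℚ))
        = p * ∑ k ∈ range N, (p : ℚ) ^ k *
          (((n / p / p ^ k : ℕ) : ℚ) - ((n / p / p ^ (k + 1) : ℕ) : ℚ)) := by
      rw [mul_sum]
      refine sum_congr rfl fun k _ => ?_
      rw [Nat.div_div_eq_div_mul, Nat.div_div_eq_div_mul, ← pow_succ', ← pow_succ']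
      ring
    have hR : ∑ i ∈ range N, ((i + 1 : ℕ) : ℚ) * a (i + 1) * (p : ℚ) ^ (i + 1)
        = p * ∑ i ∈ range N, (i : ℚ) * a (i + 1) * (p : ℚ) ^ i + p * (n / p : ℕ) := by
      rw [hdiv]
      push_cast
      rw [mul_sum, mul_sum, ← sum_add_distrib]
      exact sum_congr rfl fun i _ => by ring
    rw [hL, hR, h]
    simp only [pow_zero, Nat.div_one, zero_add, pow_one, Nat.cast_zero, zero_mul, add_zero]
    field_simp
    ring

/-- An absolute value that is at most one on the natural numbers is nonarchimedean. -/
lemma AbsoluteValue.isNonarchimedean_of_natCast_le_one {K : Type*} [Field K]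
    (v : AbsoluteValue K ℝ) (h : ∀ n : ℕ, v n ≤ 1) : IsNonarchimedean v := by
  let _ : NormedField K := v.toNormedField
  have := IsUltrametricDist.isUltrametricDist_of_forall_norm_natCast_le_one (R := K) h
  exact fun x y => IsUltrametricDist.norm_add_le_max x y

lemma IsNonarchimedean.abv_one_sub_pow_le {K : Type*} [Field K] {v : AbsoluteValue K ℝ}
    (hv : IsNonarchimedean v) {ξ : K} (hξ : v ξ = 1) (i : ℕ) : v (1 - ξ ^ i) ≤ v (1 - ξ) := by
  induction i with
  | zero => simp
  | succ i ih =>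
    have h : 1 - ξ ^ (i + 1) = (1 - ξ ^ i) + ξ ^ i * (1 - ξ) := by ring
    rw [h]
    refine (hv _ _).trans (max_le ih ?_)
    simp [hξ]

/-- All primitive roots of unity of a given order are equally far from `1`. -/
lemma IsPrimitiveRoot.abv_one_sub_eq {K : Type*} [Field K] {v : AbsoluteValue K ℝ}
    (hv : IsNonarchimedean v) {m : ℕ} (hm : m ≠ 0) {ξ η : K} (hξ : IsPrimitiveRoot ξ m)
    (hη : IsPrimitiveRoot η m) : v (1 - ξ) = v (1 - η) := by
  have key : ∀ {ξ η : K}, IsPrimitiveRoot ξ m → IsPrimitiveRoot η m →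
      v (1 - η) ≤ v (1 - ξ) := by
    intro ξ η hξ hη
    have : NeZero m := ⟨hm⟩
    obtain ⟨i, -, rfl⟩ := hξ.eq_pow_of_pow_eq_one hη.pow_eq_one
    refine hv.abv_one_sub_pow_le ?_ i
    rw [← pow_eq_one_iff_of_nonneg (v.nonneg _) hm, ← map_pow, hξ.pow_eq_one, map_one]
  exact le_antisymm (key hη hξ) (key hξ hη)

open Polynomial in
/-- The distance from `1` of a primitive root of unity of order `p ^ (j + 1)`. -/
lemma IsPrimitiveRoot.abv_one_sub_pow_totient {K : Type*} [Field K] {v : AbsoluteValue K ℝ}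
    (hv : IsNonarchimedean v) {p : ℕ} [hp : Fact p.Prime] {j : ℕ} {ξ : K}
    (hξ : IsPrimitiveRoot ξ (p ^ (j + 1))) : v (1 - ξ) ^ ((p - 1) * p ^ j) = v p := by
  have h := eval_one_cyclotomic_prime_pow (R := K) (p := p) j
  rw [cyclotomic_eq_prod_X_sub_primitiveRoots hξ, eval_prod] at h
  rw [← h, map_prod, Finset.prod_congr rfl (g := fun _ => v (1 - ξ)), Finset.prod_const,
    hξ.card_primitiveRoots, Nat.totient_prime_pow_succ hp.out, mul_comm]
  intro η hη
  rw [eval_sub, eval_X, eval_C]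
  exact IsPrimitiveRoot.abv_one_sub_eq hv (pow_pos hp.out.pos _).ne'
    (isPrimitiveRoot_of_mem_primitiveRoots hη) hξ

lemma IsPrimitiveRoot.abv_one_sub_pow {K : Type*} [Field K] {v : AbsoluteValue K ℝ}
    (hv : IsNonarchimedean v) {p : ℕ} [hp : Fact p.Prime] (hvp : v p = (p : ℝ)⁻¹) {N : ℕ} {ζ : K}
    (hζ : IsPrimitiveRoot ζ (p ^ N)) {m : ℕ} (hm0 : m ≠ 0) (hm : m < p ^ N) :
    v (1 - ζ ^ m) =
      (p : ℝ) ^ (-((p : ℝ) ^ padicValNat p m / (((p : ℝ) - 1) * (p : ℝ) ^ (N - 1)))) := by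
  have hp1 : (1 : ℝ) < p := by exact_mod_cast hp.out.one_lt
  obtain ⟨e, t, ht, rfl⟩ := Nat.exists_eq_pow_mul_and_not_dvd hm0 p hp.out.ne_one
  have ht0 : t ≠ 0 := by rintro rfl; simp at ht
  have he : e < N := by
    refine (Nat.pow_lt_pow_iff_right hp.out.one_lt).1 (lt_of_le_of_lt ?_ hm)
    exact Nat.le_mul_of_pos_right _ (Nat.pos_of_ne_zero ht0)
  have hval : padicValNat p (p ^ e * t) = e := by
    rw [padicValNat.mul (pow_pos hp.out.pos _).ne' ht0, padicValNat.prime_pow,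
      padicValNat.eq_zero_of_not_dvd ht, add_zero]
  obtain ⟨j, rfl⟩ : ∃ j, N = e + (j + 1) := ⟨N - e - 1, by omega⟩
  have hprim : IsPrimitiveRoot (ζ ^ (p ^ e * t)) (p ^ (j + 1)) := by
    rw [pow_mul]
    refine IsPrimitiveRoot.pow_of_coprime ?_ t
      (((Nat.Prime.coprime_iff_not_dvd hp.out).2 ht).symm.pow_right _)
    exact hζ.pow (pow_pos hp.out.pos _) (pow_add p e (j + 1))
  have h := hprim.abv_one_sub_pow_totient hv
  have hM : (p - 1) * p ^ j ≠ 0 :=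
    Nat.mul_ne_zero (by have := hp.out.two_le; omega) (pow_pos hp.out.pos _).ne'
  rw [hval]
  refine (pow_left_inj₀ (v.nonneg _) (by positivity) hM).1 ?_
  rw [h, hvp, ← Real.rpow_natCast, ← Real.rpow_mul (by positivity), ← Real.rpow_neg_one]
  congr 1
  have : (p : ℝ) - 1 ≠ 0 := by linarith
  have : (p : ℝ) ≠ 0 := by positivity
  have hN : e + (j + 1) - 1 = e + j := by omega
  rw [hN, pow_add]
  push_cast [Nat.cast_sub hp.out.one_le]
  field_simp


/-- **Valuation of `(ζ;ζ)_n`** (Ophir–de Shalit, Lemma 9).  `K` is an algebraic closure of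
`ℚ_p` with its unique absolute value `v` extending the `p`-adic one, `ζ` a primitive
`p^{2r}`-th root of unity, and `n = Σ_{i=0}^s a_i p^i` in base `p`.  Then
`v_p((ζ;ζ)_n) = β_p(n)/((p−1)p^{2r−1})` — expressed multiplicatively as
`|(ζ;ζ)_n| = p^{−β_p(n)/((p−1)p^{2r−1})}` — where
`β_p(n) = n + ((p−1)/p) Σ_i i a_i p^i`; moreover
`β_p(n) = Σ_{k=0}^∞ p^k (⌊n/p^k⌋ − ⌊n/p^{k+1}⌋)`. -/
theorem stmt_12 (p : ℕ) [Fact p.Prime] (r : ℕ) (hr : 1 ≤ r)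
    (K : Type*) [Field K] [Algebra ℚ_[p] K] [IsAlgClosure ℚ_[p] K]
    (v : AbsoluteValue K ℝ)
    (hv : ∀ x : ℚ_[p], v (algebraMap ℚ_[p] K x) = ‖x‖)
    (ζ : K) (hζ : IsPrimitiveRoot ζ (p ^ (2 * r)))
    (n : ℕ) (hn1 : 1 ≤ n) (hn2 : n ≤ p ^ (2 * r) - 1)
    (s : ℕ) (a : ℕ → ℕ) (ha : ∀ i, a i ≤ p - 1)
    (hdig : n = ∑ i ∈ Finset.range (s + 1), a i * p ^ i)
    (β : ℚ)
    (hβ : β = (n : ℚ) +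
        ((p : ℚ) - 1) / p * ∑ i ∈ Finset.range (s + 1), (i : ℚ) * a i * p ^ i) :
    v (∏ k ∈ Finset.range n, (1 - ζ ^ (k + 1)))
        = (p : ℝ) ^ (-((β : ℝ) / (((p : ℝ) - 1) * (p : ℝ) ^ (2 * r - 1))))
      ∧ β = ∑' k : ℕ, ((p ^ k * (n / p ^ k - n / p ^ (k + 1)) : ℕ) : ℚ) := by
  have hp : p.Prime := Fact.out
  have hlt : n < p ^ (s + 1) := hdig ▸ sum_digits_lt_pow p hp.one_le a ha (s + 1)
  have hD := sum_pow_mul_div_sub_div_eq_digits p hp.one_le (s + 1) a ha n hdig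
  rw [← hβ] at hD
  refine ⟨?_, ?_⟩
  · have hna : IsNonarchimedean v := v.isNonarchimedean_of_natCast_le_one fun m => by
      rw [← map_natCast (algebraMap ℚ_[p] K), hv]
      exact_mod_cast Padic.norm_int_le_one (p := p) m
    have hvp : v p = (p : ℝ)⁻¹ := by
      rw [← map_natCast (algebraMap ℚ_[p] K), hv, Padic.norm_p]
    have hβ' : (β : ℝ) = ∑ k ∈ Finset.range n, (p : ℝ) ^ padicValNat p (k + 1) := by
      rw [← hD, sum_pow_mul_div_sub_div_eq_sum_padicValNat p _ n hlt]
      push_cast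
      rfl
    rw [hβ', Finset.sum_div, ← Finset.sum_neg_distrib,
      Real.rpow_sum_of_pos (by exact_mod_cast hp.pos), map_prod]
    refine Finset.prod_congr rfl fun k hk => ?_
    have := Finset.mem_range.1 hk
    exact hζ.abv_one_sub_pow hna hvp (by omega) (by omega)
  · rw [tsum_eq_sum (s := Finset.range (s + 1)), ← hD]
    · refine Finset.sum_congr rfl fun k _ => ?_
      rw [Nat.cast_mul, Nat.cast_sub
        (Nat.div_le_div_left (Nat.pow_le_pow_right hp.pos k.le_succ) (pow_pos hp.pos k)),
        Nat.cast_pow]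
    · intro k hk
      have hk' : s + 1 ≤ k := by simpa using hk
      rw [Nat.div_eq_of_lt (hlt.trans_le (Nat.pow_le_pow_right hp.pos hk'))]
      simp
end

section
/- Let p be a prime and n ≥ 1 an integer with base-p expansion n = Σ_{i=0}^{s} a_i p^i (0 ≤ a_i ≤ p−1), and set β_p(n) = n + ((p−1)/p) Σ_{i=0}^{s} i a_i p^i ∈ ℚ. Then ((p−1)/p) · n · ⌊log_p n⌋ + 1 ≤ β_p(n) ≤ ((p−1)/p) · n · ⌊log_p n⌋ + n, where ⌊log_p n⌋ is the integer part of the base-p logarithm of n. -/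
/-- A number written with `k` base-`p` digits is less than `p ^ k`. -/
theorem sum_digits_mul_pow_lt {p : ℕ} (hp : 0 < p) {a : ℕ → ℕ} (ha : ∀ i, a i ≤ p - 1) (k : ℕ) :
    ∑ i ∈ Finset.range k, a i * p ^ i < p ^ k := by
  induction k with
  | zero => simp
  | succ k ih =>
    rw [Finset.sum_range_succ]
    have h := Nat.mul_le_mul_right (p ^ k) (ha k)
    obtain ⟨q, rfl⟩ : ∃ q, p = q + 1 := ⟨p - 1, by omega⟩
    rw [pow_succ, mul_add, mul_one, mul_comm _ q]
    simp only [Nat.add_sub_cancel] at h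
    omega

/-- The sum of the first `k` truncations of a base-`p` expansion, scaled by `(p - 1) / p`,
is at most `p ^ k - 1`. -/
theorem mul_sum_sub_mul_digits_le {p : ℕ} (hp : 0 < p) {a : ℕ → ℕ} (ha : ∀ i, a i ≤ p - 1)
    (k : ℕ) :
    ((p : ℚ) - 1) / p * ∑ i ∈ Finset.range k, ((k : ℚ) - i) * (a i * p ^ i) ≤ p ^ k - 1 := by
  have hp1 : (1 : ℚ) ≤ p := by exact_mod_cast hp
  have hc : 0 ≤ ((p : ℚ) - 1) / p := div_nonneg (by linarith) (by linarith)
  induction k with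
  | zero => simp
  | succ k ih =>
    have hsum : ∑ i ∈ Finset.range (k + 1), (((k + 1 : ℕ) : ℚ) - i) * (a i * p ^ i) =
        ∑ i ∈ Finset.range k, ((k : ℚ) - i) * (a i * p ^ i) +
          ∑ i ∈ Finset.range (k + 1), ((a i : ℚ) * p ^ i) := by
      rw [Finset.sum_range_succ, Finset.sum_range_succ _ k, ← add_assoc,
        ← Finset.sum_add_distrib]
      push_cast
      congr 1
      · exact Finset.sum_congr rfl fun i _ => by ring
      · ring
    have hlt : ∑ i ∈ Finset.range (k + 1), ((a i : ℚ) * p ^ i) ≤ (p : ℚ) ^ (k + 1) := by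
      exact_mod_cast (sum_digits_mul_pow_lt hp ha (k + 1)).le
    have hmul := mul_le_mul_of_nonneg_left hlt hc
    have hpow : ((p : ℚ) - 1) / p * (p : ℚ) ^ (k + 1) = p ^ (k + 1) - p ^ k := by
      field_simp
      ring
    rw [hsum, mul_add]
    linarith

/-- **Estimates for `β_p(n)`** (Ophir–de Shalit, Corollary 10).  For `n ≥ 1` with base-`p`
expansion `n = Σ_{i=0}^s a_i p^i` and `β_p(n) = n + ((p−1)/p) Σ_i i a_i p^i ∈ ℚ`, one has
`((p−1)/p)·n·⌊log_p n⌋ + 1 ≤ β_p(n) ≤ ((p−1)/p)·n·⌊log_p n⌋ + n`. -/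
theorem stmt_13 (p : ℕ) (hp : p.Prime) (n : ℕ) (hn : 1 ≤ n)
    (s : ℕ) (a : ℕ → ℕ) (ha : ∀ i, a i ≤ p - 1)
    (hdig : n = ∑ i ∈ Finset.range (s + 1), a i * p ^ i)
    (β : ℚ)
    (hβ : β = (n : ℚ) +
        ((p : ℚ) - 1) / p * ∑ i ∈ Finset.range (s + 1), (i : ℚ) * a i * p ^ i) :
    ((p : ℚ) - 1) / p * n * (Nat.log p n) + 1 ≤ β ∧
      β ≤ ((p : ℚ) - 1) / p * n * (Nat.log p n) + n := by
  have hp0 := hp.pos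
  have hp1 : (1 : ℚ) ≤ p := by exact_mod_cast hp0
  have hc : 0 ≤ ((p : ℚ) - 1) / p := div_nonneg (by linarith) (by linarith)
  have hnQ : (n : ℚ) = ∑ i ∈ Finset.range (s + 1), (a i : ℚ) * p ^ i := by
    rw [hdig]; push_cast; rfl
  have hlogs : Nat.log p n ≤ s + 1 := by
    refine (Nat.log_lt_of_lt_pow (by omega) ?_).le
    exact hdig.trans_lt (sum_digits_mul_pow_lt hp0 ha (s + 1))
  have hpow : (p : ℚ) ^ Nat.log p n ≤ n := by
    exact_mod_cast Nat.pow_log_le_self p (by omega)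
  have hdefect : (n : ℚ) * Nat.log p n - ∑ i ∈ Finset.range (s + 1), (i : ℚ) * a i * p ^ i =
      ∑ i ∈ Finset.range (s + 1), ((Nat.log p n : ℚ) - i) * (a i * p ^ i) := by
    rw [hnQ, Finset.sum_mul, ← Finset.sum_sub_distrib]
    exact Finset.sum_congr rfl fun i _ => by ring
  have hnonneg : 0 ≤ ∑ i ∈ Finset.range (s + 1), ((Nat.log p n : ℚ) - i) * (a i * p ^ i) := by
    refine Finset.sum_nonneg fun i hi => ?_
    rcases Nat.eq_zero_or_pos (a i) with h0 | h0
    · simp [h0]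
    · have hle : p ^ i ≤ n := by
        rw [hdig]
        exact (Nat.le_mul_of_pos_left _ h0).trans
          (Finset.single_le_sum (f := fun i => a i * p ^ i) (fun _ _ => Nat.zero_le _) hi)
      have hi' : (i : ℚ) ≤ Nat.log p n := by
        exact_mod_cast Nat.le_log_of_pow_le hp.one_lt hle
      exact mul_nonneg (by linarith) (by positivity)
  have hupper : ∑ i ∈ Finset.range (s + 1), ((Nat.log p n : ℚ) - i) * (a i * p ^ i) ≤
      ∑ i ∈ Finset.range (Nat.log p n), ((Nat.log p n : ℚ) - i) * (a i * p ^ i) := by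
    rw [← Finset.sum_range_add_sum_Ico _ hlogs]
    refine add_le_of_nonpos_right (Finset.sum_nonpos fun i hi => ?_)
    have hi' : (Nat.log p n : ℚ) ≤ i := by exact_mod_cast (Finset.mem_Ico.mp hi).1
    exact mul_nonpos_of_nonpos_of_nonneg (by linarith) (by positivity)
  have hlow := mul_le_mul_of_nonneg_left hupper hc
  have hbound := mul_sum_sub_mul_digits_le hp0 ha (Nat.log p n)
  have hpos := mul_nonneg hc hnonneg
  rw [← hdefect, mul_sub, ← mul_assoc] at hlow hpos
  rw [hβ]
  constructor <;> linarith
end
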